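/- Let Ω ⊂ ℝⁿ be a nonempty bounded open set. Suppose u ∈ W^{s,p(·,·)}(ℝⁿ) is a weak subsolution of (−Δ)^s_{p(·,·)}u = 0 in Ω and satisfies sup_{x∈Ω} ∫_{ℝⁿ} u₊(y)^{p(x,y)−1}(1+|y|^{n+s·p(x,y)})^{−1} dy < ∞. Then u is locally essentially bounded from above in Ω: for every x₀ ∈ Ω there exist r > 0 with B_r(x₀) ⊆ Ω and M < ∞ such that u ≤ M almost everywhere on B_r(x₀). -/

import Mathlib

open MeasureTheory Metric Set Filter
open scoped ENNReal Topology
noncomputable section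

/-- `ℝⁿ` with the Euclidean norm and Lebesgue measure. -/
abbrev Rn (n : ℕ) := EuclideanSpace ℝ (Fin n)

/-- `p₊(E × F) = sup_{x ∈ E, y ∈ F} p(x,y)`. -/
def pSup {n : ℕ} (p : Rn n → Rn n → ℝ) (E F : Set (Rn n)) : ℝ :=
  sSup (Set.image2 p E F)

/-- `p₋(E × F) = inf_{x ∈ E, y ∈ F} p(x,y)`. -/
def pInf {n : ℕ} (p : Rn n → Rn n → ℝ) (E F : Set (Rn n)) : ℝ :=
  sInf (Set.image2 p E F)

/-- Standing assumptions on the variable exponent: continuity, symmetry and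
`1 < inf p ≤ sup p < ∞`. -/
def ExponentOK {n : ℕ} (p : Rn n → Rn n → ℝ) : Prop :=
  Continuous (fun z : Rn n × Rn n => p z.1 z.2) ∧ (∀ x y, p x y = p y x) ∧
    ∃ pm pM : ℝ, 1 < pm ∧ ∀ x y, pm ≤ p x y ∧ p x y ≤ pM

/-- Membership in the fractional Sobolev space `W^{s,p(·,·)}(ℝⁿ)`. -/
def MemW {n : ℕ} (s : ℝ) (p : Rn n → Rn n → ℝ) (u : Rn n → ℝ) : Prop :=
  Measurable u ∧
    (∫⁻ x, ENNReal.ofReal (|u x| ^ p x x)) < ⊤ ∧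
    (∫⁻ x, ∫⁻ y, ENNReal.ofReal (|u x - u y| ^ p x y / ‖x - y‖ ^ ((n : ℝ) + s * p x y))) < ⊤

/-- Weak subsolution of `(-Δ)^s_{p(·,·)} u = 0` in `Ω`. -/
def IsWeakSubsol {n : ℕ} (s : ℝ) (p : Rn n → Rn n → ℝ) (Ω : Set (Rn n)) (u : Rn n → ℝ) : Prop :=
  ∀ φ : Rn n → ℝ, MemW s p φ → (∀ x, 0 ≤ φ x) → (∀ᵐ x, x ∉ Ω → φ x = 0) →
    (∫ x, ∫ y, |u x - u y| ^ (p x y - 2) * (u x - u y) * (φ x - φ y)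
      / ‖x - y‖ ^ ((n : ℝ) + s * p x y)) ≤ 0

/-- Weak supersolution of `(-Δ)^s_{p(·,·)} u = 0` in `Ω`. -/
def IsWeakSupersol {n : ℕ} (s : ℝ) (p : Rn n → Rn n → ℝ) (Ω : Set (Rn n)) (u : Rn n → ℝ) : Prop :=
  ∀ φ : Rn n → ℝ, MemW s p φ → (∀ x, 0 ≤ φ x) → (∀ᵐ x, x ∉ Ω → φ x = 0) →
    0 ≤ (∫ x, ∫ y, |u x - u y| ^ (p x y - 2) * (u x - u y) * (φ x - φ y)
      / ‖x - y‖ ^ ((n : ℝ) + s * p x y))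

/-- Weak solution of `(-Δ)^s_{p(·,·)} u = 0` in `Ω`. -/
def IsWeakSol {n : ℕ} (s : ℝ) (p : Rn n → Rn n → ℝ) (Ω : Set (Rn n)) (u : Rn n → ℝ) : Prop :=
  IsWeakSubsol s p Ω u ∧ IsWeakSupersol s p Ω u

/-- Condition (P1) in `Ω` with constant `L`. -/
def CondP1 {n : ℕ} (p : Rn n → Rn n → ℝ) (Ω : Set (Rn n)) (L : ℝ) : Prop :=
  ∀ (x₀ : Rn n) (R : ℝ), 0 < R → closedBall x₀ R ⊆ Ω →
    R ^ (pInf p (ball x₀ R) (ball x₀ R) - pSup p (ball x₀ R) (ball x₀ R)) ≤ L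

/-- Condition (P2) in `Ω`. -/
def CondP2 {n : ℕ} (p : Rn n → Rn n → ℝ) (Ω : Set (Rn n)) : Prop :=
  ∀ (x₀ : Rn n) (R : ℝ), 0 < R → closedBall x₀ R ⊆ Ω →
    pSup p (ball x₀ R) ((ball x₀ R)ᶜ) ≤ pSup p (ball x₀ R) (ball x₀ R) ∧
    pInf p (ball x₀ R) ((ball x₀ R)ᶜ) ≤ pInf p (ball x₀ R) (ball x₀ R)

/-- A radial integrable majorant of `min 1 ‖z‖ ^ p / ‖z‖ ^ (n + s p)`, uniform in `p ≥ a`. -/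
def kern (n : ℕ) (s a : ℝ) (z : Rn n) : ℝ :=
  if ‖z‖ < 1 then ‖z‖ ^ (-((n : ℝ) - (1 - s) * a)) else ‖z‖ ^ (-((n : ℝ) + s * a))

lemma kern_nonneg {n : ℕ} (s a : ℝ) (z : Rn n) : 0 ≤ kern n s a z := by
  unfold kern; split_ifs <;> positivity

lemma measurable_kern (n : ℕ) (s a : ℝ) : Measurable (kern n s a) := by
  unfold kern
  refine Measurable.ite (measurableSet_lt measurable_norm measurable_const) ?_ ?_ <;> fun_prop

lemma integrable_kern {n : ℕ} (hn : 1 ≤ n) {s a : ℝ} (hs : s ∈ Ioo (0 : ℝ) 1) (ha : 0 < a) :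
    Integrable (kern n s a) := by
  have hfin : Module.finrank ℝ (Rn n) = n := by simp
  have h1 : IntegrableOn (kern n s a) (ball 0 1) := by
    refine integrableOn_ball_of_norm_le_rpow (C := 1) (α := (n : ℝ) - (1 - s) * a) (by omega) ?_ ?_
      (measurable_kern n s a).aestronglyMeasurable
    · rw [hfin]; nlinarith [hs.2]
    · refine (ae_restrict_mem measurableSet_ball).mono fun x hx => ?_
      rw [mem_ball_zero_iff] at hx
      rw [Real.norm_of_nonneg (kern_nonneg _ _ _), kern, if_pos hx, one_mul]
  have h2 : IntegrableOn (kern n s a) (ball 0 1)ᶜ := by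
    have h3 : Integrable (fun x : Rn n => 2 ^ ((n : ℝ) + s * a) * (1 + ‖x‖) ^ (-((n : ℝ) + s * a))) := by
      refine (integrable_one_add_norm ?_).const_mul _
      rw [hfin]; nlinarith [hs.1]
    refine Integrable.mono' h3.integrableOn (measurable_kern n s a).aestronglyMeasurable ?_
    refine (ae_restrict_mem measurableSet_ball.compl).mono fun x hx => ?_
    rw [mem_compl_iff, mem_ball_zero_iff, not_lt] at hx
    rw [Real.norm_of_nonneg (kern_nonneg _ _ _), kern, if_neg (not_lt.2 hx)]
    have he : 0 ≤ (n : ℝ) + s * a := by nlinarith [hs.1, Nat.cast_nonneg (α := ℝ) n]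
    have h4 : (1 + ‖x‖) ^ ((n : ℝ) + s * a) ≤ (2 * ‖x‖) ^ ((n : ℝ) + s * a) :=
      Real.rpow_le_rpow (by positivity) (by linarith) he
    rw [Real.mul_rpow (by positivity) (by positivity)] at h4
    have h5 : 0 < ‖x‖ ^ ((n : ℝ) + s * a) := Real.rpow_pos_of_pos (by linarith) _
    rw [Real.rpow_neg (by positivity), Real.rpow_neg (by positivity), ← div_eq_mul_inv,
      inv_eq_one_div, div_le_div_iff₀ h5 (by positivity)]
    linarith
  have := h1.union h2
  rwa [union_compl_self, integrableOn_univ] at this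

lemma lintegral_kern_sub {n : ℕ} (s a : ℝ) (x : Rn n) :
    ∫⁻ y, ENNReal.ofReal (kern n s a (x - y)) = ∫⁻ y, ENNReal.ofReal (kern n s a y) :=
  lintegral_sub_left_eq_self (fun y => ENNReal.ofReal (kern n s a y)) x

lemma lintegral_kern_lt_top {n : ℕ} (hn : 1 ≤ n) {s a : ℝ} (hs : s ∈ Ioo (0 : ℝ) 1) (ha : 0 < a) :
    ∫⁻ y, ENNReal.ofReal (kern n s a y) < ⊤ :=
  (integrable_kern hn hs ha).lintegral_lt_top

lemma min_rpow_div_le_kern {n : ℕ} {s a q : ℝ} (hs : s ∈ Ioo (0 : ℝ) 1) (ha : 0 < a)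
    (hq : a ≤ q) (z : Rn n) : (min 1 ‖z‖) ^ q / ‖z‖ ^ ((n : ℝ) + s * q) ≤ kern n s a z := by
  rcases eq_or_ne z 0 with rfl | hz
  · have : (n : ℝ) + s * q ≠ 0 := by
      have := Nat.cast_nonneg (α := ℝ) n
      have := mul_pos hs.1 (ha.trans_le hq)
      positivity
    simp [Real.zero_rpow this, kern_nonneg]
  have hz' : 0 < ‖z‖ := norm_pos_iff.2 hz
  unfold kern
  split_ifs with h
  · rw [min_eq_right h.le, ← Real.rpow_sub hz']
    refine Real.rpow_le_rpow_of_exponent_ge hz' h.le ?_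
    nlinarith [hs.2]
  · rw [not_lt] at h
    rw [min_eq_left h, Real.one_rpow, one_div, ← Real.rpow_neg hz'.le]
    refine Real.rpow_le_rpow_of_exponent_le h ?_
    nlinarith [hs.1]

lemma abs_rpow_sub_two_mul_self {p t : ℝ} (hp : 1 < p) (ht : 0 ≤ t) :
    |t| ^ (p - 2) * t = t ^ (p - 1) := by
  rcases ht.eq_or_lt with rfl | ht
  · rw [mul_zero, Real.zero_rpow (by linarith)]
  · rw [abs_of_pos ht, ← Real.rpow_add_one ht.ne']; ring_nf

lemma abs_abs_rpow_sub_two_mul_self {p : ℝ} (hp : 1 < p) (t : ℝ) :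
    |(|t| ^ (p - 2) * t)| = |t| ^ (p - 1) := by
  rw [abs_mul, abs_of_nonneg (Real.rpow_nonneg (abs_nonneg t) _),
    ← abs_rpow_sub_two_mul_self hp (abs_nonneg t), abs_abs]

lemma rpow_sub_one_mul_le {p a b : ℝ} (hp : 1 < p) (ha : 0 ≤ a) (hb : 0 ≤ b) :
    a ^ (p - 1) * b ≤ a ^ p + b ^ p := by
  have key : ∀ c : ℝ, 0 ≤ c → c ^ (p - 1) * c = c ^ p := fun c hc => by
    rw [← Real.rpow_add_one' hc (by linarith)]; ring_nf
  rcases le_total b a with h | h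
  · calc a ^ (p - 1) * b ≤ a ^ (p - 1) * a := by gcongr
      _ = a ^ p := key a ha
      _ ≤ _ := le_add_of_nonneg_right (Real.rpow_nonneg hb _)
  · calc a ^ (p - 1) * b ≤ b ^ (p - 1) * b := by gcongr
      _ = b ^ p := key b hb
      _ ≤ _ := le_add_of_nonneg_left (Real.rpow_nonneg ha _)

lemma add_rpow_le_two_rpow_mul {p a b : ℝ} (hp : 0 ≤ p) (ha : 0 ≤ a) (hb : 0 ≤ b) :
    (a + b) ^ p ≤ 2 ^ p * (a ^ p + b ^ p) := by
  have ha' := Real.rpow_nonneg ha p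
  have hb' := Real.rpow_nonneg hb p
  have h2 : (0 : ℝ) ≤ 2 ^ p := by positivity
  rcases le_total b a with h | h
  · calc (a + b) ^ p ≤ (2 * a) ^ p := by gcongr; linarith
      _ = 2 ^ p * a ^ p := Real.mul_rpow (by norm_num) ha
      _ ≤ _ := by gcongr; linarith
  · calc (a + b) ^ p ≤ (2 * b) ^ p := by gcongr; linarith
      _ = 2 ^ p * b ^ p := Real.mul_rpow (by norm_num) hb
      _ ≤ _ := by gcongr; linarith

lemma truncation_flux_lower_aux {p a b k η θ : ℝ} {m : ℕ} (hp : 1 < p) (hm : p ≤ m)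
    (hη : 0 ≤ η) (hθ : 0 ≤ θ) (hθ1 : θ ≤ 1) (hab : b ≤ a) :
    -((m * max (a - k) 0 * |η - θ|) ^ p) ≤
      (a - b) ^ (p - 1) * (max (a - k) 0 * η ^ m - max (b - k) 0 * θ ^ m) := by
  have hδ : 0 ≤ (a - b) ^ (p - 1) := Real.rpow_nonneg (by linarith) _
  have hR : 0 ≤ (m * max (a - k) 0 * |η - θ|) ^ p := by positivity
  have hwab : max (b - k) 0 ≤ max (a - k) 0 := max_le_max_right _ (by linarith)
  have hwb : 0 ≤ max (b - k) 0 := le_max_right _ _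
  by_cases hpos : 0 ≤ max (a - k) 0 * η ^ m - max (b - k) 0 * θ ^ m
  · linarith [mul_nonneg hδ hpos]
  push Not at hpos
  have hηθ : η < θ := by
    by_contra! h
    have : max (b - k) 0 * θ ^ m ≤ max (a - k) 0 * η ^ m := by gcongr
    linarith
  have hbk : k ≤ b := by
    by_contra! h
    rw [max_eq_right (by linarith : b - k ≤ 0)] at hpos
    have : 0 ≤ max (a - k) 0 * η ^ m := by positivity
    linarith
  rw [max_eq_left (by linarith : 0 ≤ a - k), max_eq_left (by linarith : 0 ≤ b - k)] at *
  have hθ0 : 0 < θ := hη.trans_lt hηθ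
  have hm1 : 1 ≤ m := by
    have : (1 : ℝ) < m := by linarith
    exact_mod_cast this.le
  have hdiff : θ ^ m - η ^ m ≤ (θ - η) * m * θ ^ (m - 1) := by
    have h := abs_pow_sub_pow_le θ η m
    rw [abs_of_pos (sub_pos.2 hηθ), abs_of_pos hθ0, abs_of_nonneg hη, max_eq_left hηθ.le] at h
    exact (le_abs_self _).trans h
  rw [abs_of_neg (sub_neg.2 hηθ), neg_sub]
  set D := (m : ℝ) * (a - k) * (θ - η) with hD
  have hak : 0 ≤ a - k := by linarith
  have hD0 : 0 ≤ D := by have := sub_pos.2 hηθ; positivity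
  have h1 : (a - k) * (θ ^ m - η ^ m) ≤ D * θ ^ (m - 1) := by
    calc (a - k) * (θ ^ m - η ^ m) ≤ (a - k) * ((θ - η) * m * θ ^ (m - 1)) := by gcongr
      _ = _ := by rw [hD]; ring
  have hpow : θ ^ m = θ * θ ^ (m - 1) := by rw [← pow_succ', Nat.sub_add_cancel hm1]
  have h2 : (a - b) * θ ≤ D := by
    have : (a - b) * θ * θ ^ (m - 1) ≤ D * θ ^ (m - 1) := by
      calc (a - b) * θ * θ ^ (m - 1) = (a - b) * θ ^ m := by rw [hpow]; ring
        _ ≤ (a - k) * (θ ^ m - η ^ m) := by linarith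
        _ ≤ _ := h1
    exact le_of_mul_le_mul_right this (by positivity)
  have h3 : θ ^ (m - 1) ≤ θ ^ (p - 1) := by
    rw [← Real.rpow_natCast]
    refine Real.rpow_le_rpow_of_exponent_ge hθ0 hθ1 ?_
    rw [Nat.cast_sub hm1]; simpa using hm
  have h4 : (a - b) ^ (p - 1) * (D * θ ^ (m - 1)) ≤ D ^ p := by
    calc (a - b) ^ (p - 1) * (D * θ ^ (m - 1)) ≤ (a - b) ^ (p - 1) * (D * θ ^ (p - 1)) := by gcongr
      _ = ((a - b) * θ) ^ (p - 1) * D := by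
        rw [Real.mul_rpow (by linarith) hθ]; ring
      _ ≤ D ^ (p - 1) * D := by
        gcongr
      _ = D ^ p := by rw [← Real.rpow_add_one' hD0 (by linarith)]; ring_nf
  have h5 : -(D * θ ^ (m - 1)) ≤ (a - k) * η ^ m - (b - k) * θ ^ m := by
    have : 0 ≤ (a - b) * θ ^ m := mul_nonneg (by linarith) (by positivity)
    linarith
  have := mul_le_mul_of_nonneg_left h5 hδ
  linarith

/-- Lower bound for the `p`-flux tested with a truncation times a power of a cutoff. -/
lemma truncation_flux_lower {p a b k η θ : ℝ} {m : ℕ} (hp : 1 < p) (hm : p ≤ m)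
    (hη : 0 ≤ η) (hη1 : η ≤ 1) (hθ : 0 ≤ θ) (hθ1 : θ ≤ 1) :
    -((m * max (a - k) 0 * |η - θ|) ^ p + (m * max (b - k) 0 * |η - θ|) ^ p) ≤
      |a - b| ^ (p - 2) * (a - b) * (max (a - k) 0 * η ^ m - max (b - k) 0 * θ ^ m) := by
  have hA : 0 ≤ (m * max (a - k) 0 * |η - θ|) ^ p := by positivity
  have hB : 0 ≤ (m * max (b - k) 0 * |η - θ|) ^ p := by positivity
  rcases le_total b a with h | h
  · rw [abs_rpow_sub_two_mul_self hp (by linarith)]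
    linarith [truncation_flux_lower_aux (k := k) hp hm hη hθ hθ1 h]
  · have e : |a - b| ^ (p - 2) * (a - b) * (max (a - k) 0 * η ^ m - max (b - k) 0 * θ ^ m) =
        (b - a) ^ (p - 1) * (max (b - k) 0 * θ ^ m - max (a - k) 0 * η ^ m) := by
      rw [← abs_rpow_sub_two_mul_self hp (by linarith : 0 ≤ b - a), abs_sub_comm]; ring
    rw [e]
    have := truncation_flux_lower_aux (k := k) hp hm hθ hη hη1 h
    rw [abs_sub_comm] at this
    linarith

lemma truncation_flux_lower_of_le {p a b k η θ : ℝ} {m : ℕ} (hp : 1 < p)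
    (hη : 0 ≤ η) (ha : k < a) (hb : b ≤ k) :
    max (a - k) 0 ^ p * η ^ m ≤
      |a - b| ^ (p - 2) * (a - b) * (max (a - k) 0 * η ^ m - max (b - k) 0 * θ ^ m) := by
  rw [abs_rpow_sub_two_mul_self hp (by linarith), max_eq_right (by linarith : b - k ≤ 0),
    max_eq_left (by linarith : 0 ≤ a - k), zero_mul, sub_zero, ← mul_assoc]
  gcongr
  calc (a - k) ^ p = (a - k) ^ (p - 1) * (a - k) := by
        rw [← Real.rpow_add_one' (by linarith) (by linarith)]; ring_nf
    _ ≤ _ := by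
      gcongr

lemma lintegral_fst_mul_kern {n : ℕ} (s a : ℝ) {g : Rn n → ℝ≥0∞} (hg : Measurable g) :
    ∫⁻ z : Rn n × Rn n, g z.1 * ENNReal.ofReal (kern n s a (z.1 - z.2)) =
      (∫⁻ x, g x) * ∫⁻ y, ENNReal.ofReal (kern n s a y) := by
  have hk := measurable_kern n s a
  rw [Measure.volume_eq_prod, lintegral_prod _ (by fun_prop)]
  rw [← lintegral_mul_const _ hg]
  refine lintegral_congr fun x => ?_
  dsimp only
  rw [lintegral_const_mul _ (by fun_prop), lintegral_kern_sub]

lemma lintegral_snd_mul_kern {n : ℕ} (s a : ℝ) {g : Rn n → ℝ≥0∞} (hg : Measurable g) :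
    ∫⁻ z : Rn n × Rn n, g z.2 * ENNReal.ofReal (kern n s a (z.1 - z.2)) =
      (∫⁻ x, g x) * ∫⁻ y, ENNReal.ofReal (kern n s a y) := by
  have hk := measurable_kern n s a
  rw [← lintegral_fst_mul_kern s a hg, Measure.volume_eq_prod,
    ← lintegral_prod_swap (μ := (volume : Measure (Rn n))) (ν := (volume : Measure (Rn n)))]
  refine lintegral_congr fun z => ?_
  simp [kern, norm_sub_rev]

/-- The density of the Gagliardo modular. -/
def gagliardo {n : ℕ} (s : ℝ) (p : Rn n → Rn n → ℝ) (u : Rn n → ℝ) (z : Rn n × Rn n) : ℝ :=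
  |u z.1 - u z.2| ^ p z.1 z.2 / ‖z.1 - z.2‖ ^ ((n : ℝ) + s * p z.1 z.2)

/-- The integrand of the weak formulation. -/
def flux {n : ℕ} (s : ℝ) (p : Rn n → Rn n → ℝ) (u φ : Rn n → ℝ) (z : Rn n × Rn n) : ℝ :=
  |u z.1 - u z.2| ^ (p z.1 z.2 - 2) * (u z.1 - u z.2) * (φ z.1 - φ z.2)
    / ‖z.1 - z.2‖ ^ ((n : ℝ) + s * p z.1 z.2)

section

variable {n : ℕ} {s : ℝ} {p : Rn n → Rn n → ℝ} {u φ : Rn n → ℝ}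

lemma ExponentOK.measurable (hp : ExponentOK p) :
    Measurable (fun z : Rn n × Rn n => p z.1 z.2) := hp.1.measurable

lemma gagliardo_nonneg (z : Rn n × Rn n) : 0 ≤ gagliardo s p u z := by
  unfold gagliardo; positivity

lemma measurable_gagliardo (hp : ExponentOK p) (hu : Measurable u) :
    Measurable (gagliardo s p u) := by
  have := hp.measurable
  unfold gagliardo
  exact ((hu.comp measurable_fst).sub (hu.comp measurable_snd)).abs.pow this |>.div
    ((measurable_fst.sub measurable_snd).norm.pow (by fun_prop))

lemma measurable_flux (hp : ExponentOK p) (hu : Measurable u) (hφ : Measurable φ) :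
    Measurable (flux s p u φ) := by
  have := hp.measurable
  have hu' := (hu.comp (measurable_fst (β := Rn n))).sub (hu.comp (measurable_snd (α := Rn n)))
  have hφ' := (hφ.comp (measurable_fst (β := Rn n))).sub (hφ.comp (measurable_snd (α := Rn n)))
  unfold flux
  exact (((hu'.abs.pow (this.sub_const 2)).mul hu').mul hφ').div
    ((measurable_fst.sub measurable_snd).norm.pow (by fun_prop))

lemma MemW.lintegral_gagliardo_lt_top (hp : ExponentOK p) (hu : MemW s p u) :
    ∫⁻ z, ENNReal.ofReal (gagliardo s p u z) < ⊤ := by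
  rw [Measure.volume_eq_prod, lintegral_prod _ (measurable_gagliardo hp hu.1).ennreal_ofReal.aemeasurable]
  exact hu.2.2

lemma MemW.integrable_gagliardo (hp : ExponentOK p) (hu : MemW s p u) :
    Integrable (gagliardo s p u) := by
  refine ⟨(measurable_gagliardo hp hu.1).aestronglyMeasurable, ?_⟩
  rw [hasFiniteIntegral_iff_ofReal (Eventually.of_forall gagliardo_nonneg)]
  exact hu.lintegral_gagliardo_lt_top hp

lemma abs_flux_le {z : Rn n × Rn n} (h1 : 1 < p z.1 z.2) :
    |flux s p u φ z| ≤ gagliardo s p u z + gagliardo s p φ z := by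
  unfold flux gagliardo
  rw [← add_div, abs_div, abs_mul, abs_abs_rpow_sub_two_mul_self h1,
    abs_of_nonneg (Real.rpow_nonneg (norm_nonneg _) _)]
  gcongr
  exact rpow_sub_one_mul_le h1 (abs_nonneg _) (abs_nonneg _)

lemma ExponentOK.one_lt (hp : ExponentOK p) (x y : Rn n) : 1 < p x y := by
  obtain ⟨-, -, pm, pM, h1, h⟩ := hp
  exact h1.trans_le (h x y).1

lemma integrable_flux (hp : ExponentOK p) (hu : MemW s p u) (hφ : MemW s p φ) :
    Integrable (flux s p u φ) :=
  ((hu.integrable_gagliardo hp).add (hφ.integrable_gagliardo hp)).mono'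
    (measurable_flux hp hu.1 hφ.1).aestronglyMeasurable
    (Eventually.of_forall fun _ => abs_flux_le (hp.one_lt _ _))

lemma IsWeakSubsol.integral_flux_nonpos {Ω : Set (Rn n)} (hp : ExponentOK p) (hu : MemW s p u)
    (hsub : IsWeakSubsol s p Ω u) (hφ : MemW s p φ) (h0 : ∀ x, 0 ≤ φ x)
    (hΩ : ∀ x, x ∉ Ω → φ x = 0) : ∫ z, flux s p u φ z ≤ 0 := by
  rw [Measure.volume_eq_prod, integral_prod _ (integrable_flux hp hu hφ)]
  exact hsub φ hφ h0 (Eventually.of_forall hΩ)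

lemma gagliardo_truncation_mul_le {ζ : Rn n → ℝ} {k T L pm pM : ℝ} {B : Set (Rn n)}
    (hs : s ∈ Ioo (0 : ℝ) 1) (hpm : 1 < pm) (hpM : ∀ x y, pm ≤ p x y ∧ p x y ≤ pM)
    (hT : 0 ≤ T) (hL : 1 ≤ L) (hζ0 : ∀ x, 0 ≤ ζ x) (hζ1 : ∀ x, ζ x ≤ 1)
    (hζL : ∀ x y, |ζ x - ζ y| ≤ L * ‖x - y‖) (hζB : ∀ x, x ∉ B → ζ x = 0) (z : Rn n × Rn n) :
    gagliardo s p (fun x => min (max (u x - k) 0) T * ζ x) z ≤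
      2 ^ pM * (gagliardo s p u z + max 1 (T * L) ^ pM *
        (B.indicator 1 z.1 * kern n s pm (z.1 - z.2) +
          B.indicator 1 z.2 * kern n s pm (z.1 - z.2))) := by
  obtain ⟨x, y⟩ := z
  obtain ⟨hq, hq'⟩ := hpM x y
  have hk := kern_nonneg s pm (x - y)
  by_cases hB : x ∈ B ∨ y ∈ B
  swap
  · push Not at hB
    have : gagliardo s p (fun x => min (max (u x - k) 0) T * ζ x) (x, y) = 0 := by
      simp [gagliardo, hζB x hB.1, hζB y hB.2, Real.zero_rpow (by linarith : p x y ≠ 0)]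
    rw [this]
    have := gagliardo_nonneg (s := s) (p := p) (u := u) (x, y)
    simp only [hB, not_false_eq_true, indicator_of_notMem, zero_mul, add_zero, mul_zero]
    positivity
  have hind : kern n s pm (x - y) ≤ (B.indicator 1 x * kern n s pm (x - y) +
      B.indicator 1 y * kern n s pm (x - y)) := by
    rcases hB with hB | hB
    · rw [indicator_of_mem hB]
      simp only [Pi.one_apply, one_mul, le_add_iff_nonneg_right]
      exact mul_nonneg (indicator_nonneg (fun _ _ => zero_le_one) _) hk
    · rw [indicator_of_mem hB]
      simp only [Pi.one_apply, one_mul, le_add_iff_nonneg_left]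
      exact mul_nonneg (indicator_nonneg (fun _ _ => zero_le_one) _) hk
  set v : Rn n → ℝ := fun x => min (max (u x - k) 0) T with hv
  have hv0 : ∀ x, 0 ≤ v x := fun x => le_min (le_max_right _ _) hT
  have hvT : ∀ x, v x ≤ T := fun x => min_le_right _ _
  have hvu : |v x - v y| ≤ |u x - u y| := by
    calc |v x - v y| ≤ max |max (u x - k) 0 - max (u y - k) 0| |T - T| := abs_min_sub_min_le_max _ _ _ _
      _ = |max (u x - k) 0 - max (u y - k) 0| := by simp
      _ ≤ max |(u x - k) - (u y - k)| |(0 : ℝ) - 0| := abs_max_sub_max_le_max _ _ _ _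
      _ = _ := by simp
  have hζm : |ζ x - ζ y| ≤ L * min 1 ‖x - y‖ := by
    rw [mul_min_of_nonneg _ _ (by linarith)]
    refine le_min ?_ (hζL x y)
    have := abs_sub_le_iff.2 (⟨by linarith [hζ1 x, hζ0 y], by linarith [hζ1 y, hζ0 x]⟩ :
      ζ x - ζ y ≤ 1 ∧ ζ y - ζ x ≤ 1)
    linarith
  have hm0 : 0 ≤ min 1 ‖x - y‖ := le_min zero_le_one (norm_nonneg _)
  have hmain : |v x * ζ x - v y * ζ y| ≤ |u x - u y| + max 1 (T * L) * min 1 ‖x - y‖ := by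
    calc |v x * ζ x - v y * ζ y| = |(v x - v y) * ζ x + v y * (ζ x - ζ y)| := by ring_nf
      _ ≤ |v x - v y| * ζ x + v y * |ζ x - ζ y| := by
        refine (abs_add_le _ _).trans ?_
        rw [abs_mul, abs_mul, abs_of_nonneg (hζ0 x), abs_of_nonneg (hv0 y)]
      _ ≤ |v x - v y| * 1 + T * (L * min 1 ‖x - y‖) := by
        gcongr
        · exact hζ1 x
        · exact hvT y
      _ ≤ |u x - u y| + max 1 (T * L) * min 1 ‖x - y‖ := by
        rw [mul_one, ← mul_assoc]
        gcongr
        exact le_max_right _ _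
  have hp0 : 0 ≤ p x y := by linarith
  have hM1 : 1 ≤ max 1 (T * L) := le_max_left _ _
  have hker := min_rpow_div_le_kern (n := n) hs (by linarith : 0 < pm) hq (x - y)
  have h2 : (2 : ℝ) ^ p x y ≤ 2 ^ pM := Real.rpow_le_rpow_of_exponent_le one_le_two hq'
  have h3 : max 1 (T * L) ^ p x y ≤ max 1 (T * L) ^ pM := Real.rpow_le_rpow_of_exponent_le hM1 hq'
  calc gagliardo s p (fun x => v x * ζ x) (x, y)
      ≤ (2 ^ p x y * (|u x - u y| ^ p x y + (max 1 (T * L) * min 1 ‖x - y‖) ^ p x y)) /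
          ‖x - y‖ ^ ((n : ℝ) + s * p x y) := by
        unfold gagliardo
        dsimp only
        gcongr
        refine (Real.rpow_le_rpow (abs_nonneg _) hmain hp0).trans ?_
        exact add_rpow_le_two_rpow_mul hp0 (abs_nonneg _) (by positivity)
    _ = 2 ^ p x y * (gagliardo s p u (x, y) + max 1 (T * L) ^ p x y *
          ((min 1 ‖x - y‖) ^ p x y / ‖x - y‖ ^ ((n : ℝ) + s * p x y))) := by
        rw [Real.mul_rpow (by linarith) hm0]
        unfold gagliardo
        dsimp only
        ring
    _ ≤ 2 ^ pM * (gagliardo s p u (x, y) + max 1 (T * L) ^ pM * kern n s pm (x - y)) := by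
        have := gagliardo_nonneg (s := s) (p := p) (u := u) (x, y)
        gcongr
    _ ≤ _ := by
        dsimp only
        gcongr

lemma memW_truncation_mul {ζ : Rn n → ℝ} {k T L : ℝ} {B : Set (Rn n)} (hn : 1 ≤ n)
    (hs : s ∈ Ioo (0 : ℝ) 1) (hp : ExponentOK p) (hu : MemW s p u) (hk : 0 ≤ k)
    (hT : 0 ≤ T) (hL : 1 ≤ L) (hζm : Measurable ζ) (hζ0 : ∀ x, 0 ≤ ζ x) (hζ1 : ∀ x, ζ x ≤ 1)
    (hζL : ∀ x y, |ζ x - ζ y| ≤ L * ‖x - y‖) (hζB : ∀ x, x ∉ B → ζ x = 0)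
    (hBm : MeasurableSet B) (hB : volume B < ⊤) :
    MemW s p (fun x => min (max (u x - k) 0) T * ζ x) := by
  have hp' := hp
  obtain ⟨hpc, -, pm, pM, hpm, hpM⟩ := hp'
  have hum := hu.1
  have hmeas : Measurable (fun x => min (max (u x - k) 0) T * ζ x) := by fun_prop
  refine ⟨hmeas, ?_, ?_⟩
  · refine lt_of_le_of_lt (lintegral_mono fun x => ENNReal.ofReal_le_ofReal ?_) hu.2.1
    have hv0 : 0 ≤ min (max (u x - k) 0) T := le_min (le_max_right _ _) hT
    refine Real.rpow_le_rpow (abs_nonneg _) ?_ (by linarith [(hpM x x).1])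
    rw [abs_mul, abs_of_nonneg (hζ0 x), abs_of_nonneg hv0]
    calc min (max (u x - k) 0) T * ζ x ≤ min (max (u x - k) 0) T * 1 := by
          gcongr; exact hζ1 x
      _ ≤ max (u x - k) 0 := by rw [mul_one]; exact min_le_left _ _
      _ ≤ |u x| := max_le (by linarith [le_abs_self (u x)]) (abs_nonneg _)
  · have hkm := measurable_kern n s pm
    have hK := lintegral_kern_lt_top (n := n) hn hs (by linarith : 0 < pm)
    have hind : Measurable (B.indicator (1 : Rn n → ℝ)) := measurable_one.indicator hBm
    have hg : ∫⁻ x, ENNReal.ofReal (B.indicator (1 : Rn n → ℝ) x) < ⊤ := by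
      have : ∀ x, ENNReal.ofReal (B.indicator (1 : Rn n → ℝ) x) = B.indicator 1 x := fun x => by
        by_cases h : x ∈ B <;> simp [h]
      simp_rw [this]
      rwa [lintegral_indicator_one hBm]
    have e : ∫⁻ x, ∫⁻ y, ENNReal.ofReal (|min (max (u x - k) 0) T * ζ x -
        min (max (u y - k) 0) T * ζ y| ^ p x y / ‖x - y‖ ^ ((n : ℝ) + s * p x y)) =
        ∫⁻ z, ENNReal.ofReal (gagliardo s p (fun x => min (max (u x - k) 0) T * ζ x) z) := by
      rw [Measure.volume_eq_prod,
        lintegral_prod _ (measurable_gagliardo hp hmeas).ennreal_ofReal.aemeasurable]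
      rfl
    rw [e]
    have hgm := measurable_gagliardo (s := s) hp hu.1
    calc _ ≤ ∫⁻ z : Rn n × Rn n, ENNReal.ofReal (2 ^ pM) * (ENNReal.ofReal (gagliardo s p u z) +
          ENNReal.ofReal (max 1 (T * L) ^ pM) *
          (ENNReal.ofReal (B.indicator 1 z.1) * ENNReal.ofReal (kern n s pm (z.1 - z.2)) +
          ENNReal.ofReal (B.indicator 1 z.2) * ENNReal.ofReal (kern n s pm (z.1 - z.2)))) := by
          refine lintegral_mono fun z => ?_
          refine (ENNReal.ofReal_le_ofReal (gagliardo_truncation_mul_le hs hpm hpM hT hL hζ0 hζ1 hζL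
            hζB z)).trans (le_of_eq ?_)
          have h0 : ∀ x, 0 ≤ B.indicator (1 : Rn n → ℝ) x :=
            fun x => indicator_nonneg (fun _ _ => zero_le_one) _
          have h1 := kern_nonneg s pm (z.1 - z.2)
          have h2 := h0 z.1
          have h3 := h0 z.2
          rw [ENNReal.ofReal_mul (by positivity), ENNReal.ofReal_add (gagliardo_nonneg _)
            (by positivity), ENNReal.ofReal_mul (by positivity), ENNReal.ofReal_add (by positivity)
            (by positivity), ENNReal.ofReal_mul h2, ENNReal.ofReal_mul h3]
      _ < ⊤ := by
          rw [lintegral_const_mul _ (by fun_prop), lintegral_add_left (by fun_prop),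
            lintegral_const_mul _ (by fun_prop), lintegral_add_left (by fun_prop),
            lintegral_fst_mul_kern s pm hind.ennreal_ofReal,
            lintegral_snd_mul_kern s pm hind.ennreal_ofReal]
          have := hu.lintegral_gagliardo_lt_top hp
          finiteness

end

lemma volume_ball_eq {n : ℕ} (x : Rn n) {r : ℝ} (hr : 0 < r) :
    volume (ball x r) = ENNReal.ofReal (r ^ n) * volume (ball (0 : Rn n) 1) := by
  rw [Measure.addHaar_ball_of_pos _ _ hr]; simp

/-- If a set `E` fills at most half of each ball `B_ρ(x)`, `x ∈ A`, then the interaction of `A` with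
the complement of `E` controls integrals over `A` with a gain `ρ ^ t`. -/
lemma setLIntegral_le_of_interaction {n : ℕ} {A E : Set (Rn n)} {ρ t : ℝ} {g : Rn n → ℝ≥0∞}
    {f : Rn n × Rn n → ℝ≥0∞} (hρ : 0 < ρ) (hA : MeasurableSet A) (hE : MeasurableSet E)
    (hf : Measurable f)
    (hhalf : ∀ x ∈ A, 2 * volume (E ∩ ball x ρ) ≤ volume (ball x ρ))
    (hfg : ∀ x ∈ A, ∀ y ∈ ball x ρ, y ∉ E → g x * ENNReal.ofReal (ρ ^ (-((n : ℝ) + t))) ≤ f (x, y)) :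
    ∫⁻ x in A, g x ≤ ENNReal.ofReal (ρ ^ t) * (2 / volume (ball (0 : Rn n) 1)) * ∫⁻ z, f z := by
  set ω := volume (ball (0 : Rn n) 1) with hω
  have hω0 : ω ≠ 0 := (measure_ball_pos _ _ one_pos).ne'
  have hωt : ω ≠ ⊤ := measure_ball_lt_top.ne
  have h1 : ∀ x ∈ A, g x ≤ ENNReal.ofReal (ρ ^ t) * (2 / ω) * ∫⁻ y, f (x, y) := by
    intro x hx
    have hvol : volume (ball x ρ) ≤ 2 * volume (ball x ρ \ E) := by
      have h := measure_sdiff_add_inter (μ := volume) (s := ball x ρ) hE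
      have h2 := hhalf x hx
      rw [inter_comm] at h2
      have hfin : volume (ball x ρ ∩ E) ≠ ⊤ :=
        ((measure_mono inter_subset_left).trans_lt measure_ball_lt_top).ne
      rw [← h, two_mul] at h2
      rw [← h, two_mul]
      exact add_le_add_right ((ENNReal.add_le_add_iff_right hfin).1 h2) _
    have hlow : g x * ENNReal.ofReal (ρ ^ (-((n : ℝ) + t))) * volume (ball x ρ \ E) ≤
        ∫⁻ y, f (x, y) := by
      rw [← setLIntegral_const]
      exact (setLIntegral_mono' (measurableSet_ball.diff hE)
        (fun y hy => hfg x hx y hy.1 hy.2)).trans (setLIntegral_le_lintegral _ _)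
    rw [volume_ball_eq x hρ] at hvol
    have hone : ENNReal.ofReal (ρ ^ t) * ENNReal.ofReal (ρ ^ (-((n : ℝ) + t))) *
        ENNReal.ofReal (ρ ^ n) = 1 := by
      rw [← ENNReal.ofReal_mul (by positivity), ← ENNReal.ofReal_mul (by positivity),
        ← Real.rpow_natCast, ← Real.rpow_add hρ, ← Real.rpow_add hρ]
      simp
    calc g x = g x * (ENNReal.ofReal (ρ ^ t) * ENNReal.ofReal (ρ ^ (-((n : ℝ) + t))) *
        ENNReal.ofReal (ρ ^ n)) * (ω / ω) := by
          rw [hone, ENNReal.div_self hω0 hωt]; simp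
      _ = g x * (ENNReal.ofReal (ρ ^ t) * ENNReal.ofReal (ρ ^ (-((n : ℝ) + t)))) * ω⁻¹ *
        (ENNReal.ofReal (ρ ^ n) * ω) := by rw [div_eq_mul_inv]; ring
      _ ≤ g x * (ENNReal.ofReal (ρ ^ t) * ENNReal.ofReal (ρ ^ (-((n : ℝ) + t)))) * ω⁻¹ *
        (2 * volume (ball x ρ \ E)) := by gcongr
      _ = ENNReal.ofReal (ρ ^ t) * (2 / ω) *
        (g x * ENNReal.ofReal (ρ ^ (-((n : ℝ) + t))) * volume (ball x ρ \ E)) := by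
          rw [div_eq_mul_inv]; ring
      _ ≤ _ := by gcongr
  calc ∫⁻ x in A, g x ≤ ∫⁻ x in A, ENNReal.ofReal (ρ ^ t) * (2 / ω) * ∫⁻ y, f (x, y) :=
        setLIntegral_mono' hA h1
    _ ≤ ∫⁻ x, ENNReal.ofReal (ρ ^ t) * (2 / ω) * ∫⁻ y, f (x, y) := setLIntegral_le_lintegral _ _
    _ = _ := by
      rw [lintegral_const_mul _ hf.lintegral_prod_right', Measure.volume_eq_prod,
        lintegral_prod _ hf.aemeasurable]

lemma lintegral_rpow_lt_top_of_weak {α : Type*} [MeasurableSpace α] {μ : Measure α}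
    [IsFiniteMeasure μ] {f : α → ℝ} (hf : Measurable f) (hf0 : ∀ x, 0 ≤ f x) {C t₀ q r : ℝ}
    (ht₀ : 0 < t₀) (hq : 0 < q) (hqr : q < r)
    (h : ∀ t, t₀ < t → μ {x | t < f x} ≤ ENNReal.ofReal (C * t ^ (-r))) :
    ∫⁻ x, ENNReal.ofReal (f x ^ q) ∂μ < ⊤ := by
  rw [lintegral_rpow_eq_lintegral_meas_lt_mul μ (Eventually.of_forall hf0) hf.aemeasurable hq]
  refine ENNReal.mul_lt_top ENNReal.ofReal_lt_top ?_
  rw [← Ioc_union_Ioi_eq_Ioi ht₀.le]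
  refine (lintegral_union_le _ _ _).trans_lt (ENNReal.add_lt_top.2 ⟨?_, ?_⟩)
  · calc _ ≤ ∫⁻ t in Ioc 0 t₀, μ univ * ENNReal.ofReal (t ^ (q - 1)) := by
          gcongr; exact subset_univ _
      _ < ⊤ := by
        rw [lintegral_const_mul _ (by fun_prop)]
        refine ENNReal.mul_lt_top (measure_lt_top _ _) ?_
        have := (intervalIntegral.intervalIntegrable_rpow' (a := 0) (b := t₀)
          (by linarith : -1 < q - 1)).1
        exact this.lintegral_lt_top
  · have hint : IntegrableOn (fun t : ℝ => C * t ^ (q - 1 - r)) (Ioi t₀) :=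
      (integrableOn_Ioi_rpow_of_lt (by linarith) ht₀).const_mul C
    refine lt_of_le_of_lt (setLIntegral_mono' measurableSet_Ioi fun t ht => ?_)
      hint.lintegral_lt_top
    have ht' : 0 < t := ht₀.trans ht
    calc _ ≤ ENNReal.ofReal (C * t ^ (-r)) * ENNReal.ofReal (t ^ (q - 1)) := by
          gcongr; exact h t ht
      _ = _ := by
        rw [← ENNReal.ofReal_mul' (by positivity), mul_assoc, ← Real.rpow_add ht']
        ring_nf

/-- A nonlocal energy bound yields local integrability beyond the natural exponent. -/
lemma MemW.lintegral_rpow_lt_top {n : ℕ} (hn : 1 ≤ n) {s : ℝ} (hs : s ∈ Ioo (0 : ℝ) 1)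
    {p : Rn n → Rn n → ℝ} (hp : ExponentOK p) {u : Rn n → ℝ} (hu : MemW s p u) {x₀ : Rn n}
    {R P₁ q : ℝ} (hR : 0 < R) (hP₁ : 0 < P₁)
    (hpB : ∀ x ∈ ball x₀ (2 * R), ∀ y ∈ ball x₀ (2 * R), P₁ ≤ p x y)
    (hq : 0 < q) (hqP : q < P₁ + s * P₁ * (P₁ / n)) :
    ∫⁻ x in ball x₀ R, ENNReal.ofReal (max (u x) 0 ^ q) < ⊤ := by
  have hum := hu.1
  have hn0 : (0 : ℝ) < n := by exact_mod_cast hn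
  set ω := volume (ball (0 : Rn n) 1) with hω
  have hω0 : ω ≠ 0 := (measure_ball_pos _ _ one_pos).ne'
  have hωt : ω ≠ ⊤ := measure_ball_lt_top.ne
  obtain ⟨S, hS0, hS⟩ : ∃ S : ℝ, 0 < S ∧ ∫⁻ x, ENNReal.ofReal (|u x| ^ p x x) ≤ ENNReal.ofReal S :=
    ⟨(∫⁻ x, ENNReal.ofReal (|u x| ^ p x x)).toReal + 1, by positivity, by
      rw [ENNReal.ofReal_add (by positivity) zero_le_one, ENNReal.ofReal_toReal hu.2.1.ne]
      exact le_self_add⟩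
  have hpow : ∀ k v e : ℝ, 1 ≤ k → k < v → P₁ ≤ e → k ^ P₁ ≤ v ^ e := fun k v e hk hv he =>
    (Real.rpow_le_rpow (by linarith) hv.le hP₁.le).trans
      (Real.rpow_le_rpow_of_exponent_le (by linarith) he)
  have hlevel : ∀ k : ℝ, 1 ≤ k →
      volume ({x | k < u x} ∩ ball x₀ (2 * R)) ≤ ENNReal.ofReal (S * k ^ (-P₁)) := by
    intro k hk
    have hk0 : 0 < k := by linarith
    have h1 : ENNReal.ofReal (k ^ P₁) * volume ({x | k < u x} ∩ ball x₀ (2 * R)) ≤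
        ENNReal.ofReal S := by
      refine le_trans ?_ hS
      rw [← setLIntegral_const]
      refine (setLIntegral_mono' ((measurableSet_lt measurable_const hum).inter measurableSet_ball)
        fun x hx => ENNReal.ofReal_le_ofReal ?_).trans (setLIntegral_le_lintegral _ _)
      exact hpow k _ _ hk (lt_of_lt_of_le hx.1 (le_abs_self _)) (hpB x hx.2 x hx.2)
    calc _ = ENNReal.ofReal (k ^ (-P₁)) * (ENNReal.ofReal (k ^ P₁) *
          volume ({x | k < u x} ∩ ball x₀ (2 * R))) := by
          rw [← mul_assoc, ← ENNReal.ofReal_mul (by positivity), ← Real.rpow_add hk0]; simp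
      _ ≤ ENNReal.ofReal (k ^ (-P₁)) * ENNReal.ofReal S := by gcongr
      _ = _ := by rw [← ENNReal.ofReal_mul (by positivity), mul_comm]
  set c := (2 * S / ω.toReal) ^ (1 / (n : ℝ)) with hc
  have hωr : 0 < ω.toReal := ENNReal.toReal_pos hω0 hωt
  have hdiv : 2 / ω = ENNReal.ofReal (2 / ω.toReal) := by
    rw [ENNReal.ofReal_div_of_pos hωr, ENNReal.ofReal_toReal hωt, ENNReal.ofReal_ofNat]
  have hc0 : 0 < c := by positivity
  have hcn : c ^ n = 2 * S / ω.toReal := by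
    rw [hc, ← Real.rpow_natCast, ← Real.rpow_mul (by positivity), one_div,
      inv_mul_cancel₀ hn0.ne', Real.rpow_one]
  have htend : Tendsto (fun k : ℝ => c * k ^ (-(P₁ / n))) atTop (𝓝 (c * 0)) :=
    (tendsto_rpow_neg_atTop (by positivity)).const_mul c
  rw [mul_zero] at htend
  obtain ⟨k₀, hk₀⟩ := eventually_atTop.1 (htend.eventually_lt_const (lt_min one_pos hR))
  obtain ⟨G, hG0, hG⟩ : ∃ G : ℝ, 0 ≤ G ∧ ∫⁻ z, ENNReal.ofReal (gagliardo s p u z) = ENNReal.ofReal G :=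
    ⟨_, ENNReal.toReal_nonneg, (ENNReal.ofReal_toReal (hu.lintegral_gagliardo_lt_top hp).ne).symm⟩
  have hgain : ∀ k : ℝ, max 1 k₀ ≤ k → volume ({x | 2 * k < u x} ∩ ball x₀ R) ≤
      ENNReal.ofReal (c ^ (s * P₁) * (2 / ω.toReal) * G * k ^ (-(P₁ + s * P₁ * (P₁ / n)))) := by
    intro k hk
    have hk1 : 1 ≤ k := (le_max_left _ _).trans hk
    have hk0 : 0 < k := by linarith
    set ρ := c * k ^ (-(P₁ / n)) with hρ
    have hρ0 : 0 < ρ := by positivity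
    have hρ1 := hk₀ k ((le_max_right _ _).trans hk)
    rw [lt_min_iff] at hρ1
    have hρn : ENNReal.ofReal (ρ ^ n) * ω = 2 * ENNReal.ofReal (S * k ^ (-P₁)) := by
      have e1 : ρ ^ n = 2 * S / ω.toReal * k ^ (-P₁) := by
        rw [hρ, mul_pow, hcn, ← Real.rpow_natCast (k ^ _), ← Real.rpow_mul hk0.le]
        congr 2
        field_simp
      rw [e1, ← ENNReal.ofReal_toReal hωt, ← ENNReal.ofReal_mul (by positivity),
        show (2 : ℝ≥0∞) = ENNReal.ofReal 2 by simp, ← ENNReal.ofReal_mul (by positivity)]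
      congr 1
      rw [ENNReal.ofReal_toReal hωt]
      field_simp
    have hEm : MeasurableSet ({x | k < u x} ∩ ball x₀ (2 * R)) :=
      (measurableSet_lt measurable_const hum).inter measurableSet_ball
    have hAm : MeasurableSet ({x | 2 * k < u x} ∩ ball x₀ R) :=
      (measurableSet_lt measurable_const hum).inter measurableSet_ball
    have key := setLIntegral_le_of_interaction (A := {x | 2 * k < u x} ∩ ball x₀ R)
      (E := {x | k < u x} ∩ ball x₀ (2 * R)) (t := s * P₁) (g := fun _ => ENNReal.ofReal (k ^ P₁))
      (f := fun z => ENNReal.ofReal (gagliardo s p u z)) hρ0 hAm hEm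
      (measurable_gagliardo hp hum).ennreal_ofReal ?_ ?_
    · rw [setLIntegral_const, hG, ← hω, hdiv,
        ← ENNReal.ofReal_mul (by positivity), ← ENNReal.ofReal_mul (by positivity)] at key
      calc volume ({x | 2 * k < u x} ∩ ball x₀ R) =
            ENNReal.ofReal (k ^ (-P₁)) * (ENNReal.ofReal (k ^ P₁) *
              volume ({x | 2 * k < u x} ∩ ball x₀ R)) := by
            rw [← mul_assoc, ← ENNReal.ofReal_mul (by positivity), ← Real.rpow_add hk0]; simp
        _ ≤ ENNReal.ofReal (k ^ (-P₁)) * ENNReal.ofReal (ρ ^ (s * P₁) * (2 / ω.toReal) * G) := by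
            gcongr
        _ = _ := by
            rw [← ENNReal.ofReal_mul (by positivity), hρ, Real.mul_rpow hc0.le (by positivity),
              ← Real.rpow_mul hk0.le]
            congr 1
            rw [show -(P₁ + s * P₁ * (P₁ / n)) = -P₁ + -(P₁ / n) * (s * P₁) by ring,
              Real.rpow_add hk0]
            ring
    · intro x _
      rw [volume_ball_eq x hρ0, hρn]
      gcongr
      exact (measure_mono inter_subset_left).trans (hlevel k hk1)
    · rintro x ⟨hxu, hxR⟩ y hy hyE
      have hy2 : y ∈ ball x₀ (2 * R) := by
        have := dist_triangle y x x₀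
        rw [mem_ball] at *
        linarith
      have hyk : u y ≤ k := by
        by_contra! h
        exact hyE ⟨h, hy2⟩
      have hx2 : x ∈ ball x₀ (2 * R) := ball_subset_ball (by linarith) hxR
      have hpxy := hpB x hx2 y hy2
      rw [mem_ofPred_eq] at hxu
      rw [← ENNReal.ofReal_mul (by positivity)]
      refine ENNReal.ofReal_le_ofReal ?_
      have hxy : ‖x - y‖ < ρ := by rwa [mem_ball, dist_eq_norm, norm_sub_rev] at hy
      have hxy0 : 0 < ‖x - y‖ := norm_pos_iff.2 (sub_ne_zero.2 fun h => by rw [h] at hxu; linarith)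
      rw [gagliardo, Real.rpow_neg hρ0.le, ← div_eq_mul_inv]
      dsimp only
      refine div_le_div₀ (by positivity) ?_ (by positivity) ?_
      · exact hpow k _ _ hk1 (lt_of_lt_of_le (by linarith) (le_abs_self _)) hpxy
      · calc ‖x - y‖ ^ ((n : ℝ) + s * p x y) ≤ ‖x - y‖ ^ ((n : ℝ) + s * P₁) :=
              Real.rpow_le_rpow_of_exponent_ge hxy0 (by linarith) (by nlinarith [hs.1])
          _ ≤ ρ ^ ((n : ℝ) + s * P₁) := by
              have := hs.1
              gcongr
  have : IsFiniteMeasure (volume.restrict (ball x₀ R)) := ⟨by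
    rw [Measure.restrict_apply_univ]; exact measure_ball_lt_top⟩
  refine lintegral_rpow_lt_top_of_weak (t₀ := 2 * max 1 k₀) (r := P₁ + s * P₁ * (P₁ / n))
    (C := c ^ (s * P₁) * (2 / ω.toReal) * G * 2 ^ (P₁ + s * P₁ * (P₁ / n)))
    (hum.max measurable_const) (fun x => le_max_right _ _) (by positivity) hq hqP fun t ht => ?_
  have ht0 : 0 < t := lt_trans (by positivity) ht
  have h := hgain (t / 2) (by linarith)
  rw [Measure.restrict_apply (measurableSet_lt measurable_const (hum.max measurable_const))]
  refine (measure_mono ?_).trans (h.trans (ENNReal.ofReal_le_ofReal (le_of_eq ?_)))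
  · rintro x ⟨hx, hxB⟩
    refine ⟨?_, hxB⟩
    rw [mem_ofPred_eq] at hx ⊢
    rcases lt_max_iff.1 hx with h | h
    · linarith
    · linarith
  · rw [Real.div_rpow ht0.le (by norm_num), Real.rpow_neg (by norm_num : (0 : ℝ) ≤ 2),
      div_inv_eq_mul]
    ring

/-- The function `1 + (u - k)₊ ^ P` on the superlevel set `{u > k} ∩ B`, extended by zero. -/
def excess {n : ℕ} (u : Rn n → ℝ) (B : Set (Rn n)) (k P : ℝ) : Rn n → ℝ :=
  ({x | k < u x} ∩ B).indicator fun x => 1 + max (u x - k) 0 ^ P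

/-- A piecewise linear radial cutoff, equal to `1` on `B_{r'}` and vanishing outside
`B_{r' + g / 2}`. -/
def cutoff {n : ℕ} (x₀ : Rn n) (r' g : ℝ) (x : Rn n) : ℝ :=
  max 0 (min 1 (1 - 2 / g * (dist x x₀ - r')))

section

variable {n : ℕ} {s : ℝ} {p : Rn n → Rn n → ℝ} {u φ : Rn n → ℝ} {B : Set (Rn n)} {x₀ : Rn n}
  {k P r' g : ℝ}

lemma excess_nonneg (x : Rn n) : 0 ≤ excess u B k P x :=
  indicator_nonneg (fun _ _ => add_nonneg zero_le_one (Real.rpow_nonneg (le_max_right _ _) _)) x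

lemma measurable_excess (hu : Measurable u) (hB : MeasurableSet B) :
    Measurable (excess u B k P) :=
  Measurable.indicator (by fun_prop) ((measurableSet_lt measurable_const hu).inter hB)

lemma rpow_le_one_add_rpow {w q : ℝ} (hw : 0 ≤ w) (hq : 0 ≤ q) (hqP : q ≤ P) :
    w ^ q ≤ 1 + w ^ P := by
  have hP := Real.rpow_nonneg hw P
  rcases le_total w 1 with h | h
  · linarith [Real.rpow_le_one hw h hq]
  · linarith [Real.rpow_le_rpow_of_exponent_le h hqP]

lemma truncation_rpow_le_excess {q : ℝ} (hq : 0 < q) (hqP : q ≤ P) {x : Rn n} (hx : x ∈ B) :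
    max (u x - k) 0 ^ q ≤ excess u B k P x := by
  by_cases h : k < u x
  · rw [excess, indicator_of_mem (show x ∈ {x | k < u x} ∩ B from ⟨h, hx⟩)]
    exact rpow_le_one_add_rpow (le_max_right _ _) hq.le hqP
  · rw [max_eq_right (by linarith), Real.zero_rpow hq.ne']
    exact excess_nonneg _

lemma lintegral_excess_lt_top (hk : 0 ≤ k) (hP : 0 ≤ P)
    (hB : MeasurableSet B) (hBv : volume B < ⊤)
    (hint : ∫⁻ x in B, ENNReal.ofReal (max (u x) 0 ^ P) < ⊤) :
    ∫⁻ x, ENNReal.ofReal (excess u B k P x) < ⊤ := by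
  calc ∫⁻ x, ENNReal.ofReal (excess u B k P x)
      ≤ ∫⁻ x, B.indicator (fun x => 1 + ENNReal.ofReal (max (u x) 0 ^ P)) x := by
        refine lintegral_mono fun x => ?_
        by_cases h : x ∈ {x | k < u x} ∩ B
        · rw [excess, indicator_of_mem h, indicator_of_mem h.2,
            ENNReal.ofReal_add zero_le_one (by positivity), ENNReal.ofReal_one]
          gcongr
          linarith
        · rw [excess, indicator_of_notMem h]; simp
    _ < ⊤ := by
        rw [lintegral_indicator hB, lintegral_add_left measurable_const]
        simp only [lintegral_const, Measure.restrict_apply MeasurableSet.univ, univ_inter, one_mul]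
        exact ENNReal.add_lt_top.2 ⟨hBv, hint⟩

lemma cutoff_nonneg (x : Rn n) : 0 ≤ cutoff x₀ r' g x := le_max_left _ _

lemma cutoff_le_one (x : Rn n) : cutoff x₀ r' g x ≤ 1 := max_le zero_le_one (min_le_left _ _)

lemma continuous_cutoff : Continuous (cutoff x₀ r' g) := by unfold cutoff; fun_prop

lemma cutoff_eq_one (hg : 0 < g) {x : Rn n} (hx : x ∈ ball x₀ r') : cutoff x₀ r' g x = 1 := by
  rw [mem_ball] at hx
  have : 0 ≤ 2 / g * (r' - dist x x₀) := mul_nonneg (by positivity) (by linarith)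
  rw [cutoff, min_eq_left (by linarith), max_eq_right zero_le_one]

lemma cutoff_eq_zero (hg : 0 < g) {x : Rn n} (hx : x ∉ ball x₀ (r' + g / 2)) :
    cutoff x₀ r' g x = 0 := by
  rw [mem_ball, not_lt] at hx
  have : 2 / g * (g / 2) ≤ 2 / g * (dist x x₀ - r') := by gcongr; linarith
  have h1 : 2 / g * (g / 2) = 1 := by field_simp
  rw [cutoff, max_eq_left]
  exact (min_le_right _ _).trans (by linarith)

lemma abs_cutoff_sub_le (hg : 0 < g) (x y : Rn n) :
    |cutoff x₀ r' g x - cutoff x₀ r' g y| ≤ 2 / g * ‖x - y‖ := by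
  unfold cutoff
  refine (abs_max_sub_max_le_max _ _ _ _).trans (max_le (by simp; positivity) ?_)
  refine (abs_min_sub_min_le_max _ _ _ _).trans (max_le (by simp; positivity) ?_)
  have : 1 - 2 / g * (dist x x₀ - r') - (1 - 2 / g * (dist y x₀ - r')) =
      2 / g * (dist y x₀ - dist x x₀) := by ring
  rw [this, abs_mul, abs_of_nonneg (by positivity), ← dist_eq_norm, dist_comm x y]
  gcongr
  exact abs_dist_sub_le y x x₀

lemma abs_cutoff_pow_sub_le (hg : 0 < g) (m : ℕ) (x y : Rn n) :
    |cutoff x₀ r' g x ^ m - cutoff x₀ r' g y ^ m| ≤ 2 * m / g * ‖x - y‖ := by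
  have h := abs_pow_sub_pow_le (cutoff x₀ r' g x) (cutoff x₀ r' g y) m
  rw [abs_of_nonneg (cutoff_nonneg x), abs_of_nonneg (cutoff_nonneg y)] at h
  calc _ ≤ _ := h
    _ ≤ 2 / g * ‖x - y‖ * m * 1 := by
      gcongr
      · exact pow_nonneg (le_max_of_le_left (cutoff_nonneg x)) _
      · exact abs_cutoff_sub_le hg x y
      · exact pow_le_one₀ (le_max_of_le_left (cutoff_nonneg x))
          (max_le (cutoff_le_one x) (cutoff_le_one y))
    _ = _ := by ring

lemma flux_swap (hp : ExponentOK p) (z : Rn n × Rn n) :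
    flux s p u φ z.swap = flux s p u φ z := by
  unfold flux
  simp only [Prod.fst_swap, Prod.snd_swap]
  rw [hp.2.1 z.2 z.1, norm_sub_rev, abs_sub_comm]
  congr 1
  ring

/-- The density of the interaction with the far field. -/
def tailDensity (s : ℝ) (p : Rn n → Rn n → ℝ) (u : Rn n → ℝ) (A B : Set (Rn n)) (k : ℝ)
    (z : Rn n × Rn n) : ℝ :=
  (A ×ˢ Bᶜ).indicator (fun z => max (u z.1 - k) 0 * (max (u z.2) 0 ^ (p z.1 z.2 - 1)
    / ‖z.1 - z.2‖ ^ ((n : ℝ) + s * p z.1 z.2))) z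

lemma tailDensity_nonneg {A : Set (Rn n)} (z : Rn n × Rn n) : 0 ≤ tailDensity s p u A B k z :=
  indicator_nonneg (fun z _ => by positivity) z

lemma measurable_tailDensity (hp : ExponentOK p) (hu : Measurable u) {A : Set (Rn n)}
    (hA : MeasurableSet A) (hB : MeasurableSet B) :
    Measurable (tailDensity s p u A B k) := by
  have := hp.measurable
  have h1 : Measurable fun z : Rn n × Rn n => u z.1 := hu.comp measurable_fst
  have h2 : Measurable fun z : Rn n × Rn n => u z.2 := hu.comp measurable_snd
  refine Measurable.indicator ?_ (hA.prod hB.compl)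
  exact ((h1.sub_const k).max measurable_const).mul
    (((h2.max measurable_const).pow (this.sub_const 1)).div
      ((measurable_fst.sub measurable_snd).norm.pow (by fun_prop)))

lemma neg_tailDensity_le_flux (hp : ExponentOK p) {A : Set (Rn n)} (hk : 0 ≤ k)
    (hφ0 : ∀ x, 0 ≤ φ x) (hφu : ∀ x, φ x ≤ max (u x - k) 0) (hφA : ∀ x, x ∉ A → φ x = 0)
    (hAB : A ⊆ B) {x y : Rn n} (hy : y ∉ B) :
    -tailDensity s p u A B k (x, y) ≤ flux s p u φ (x, y) := by
  have hφy : φ y = 0 := hφA y fun h => hy (hAB h)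
  have h0 := tailDensity_nonneg (s := s) (p := p) (u := u) (B := B) (k := k) (A := A) (x, y)
  have h1 := hp.one_lt x y
  rcases (hφ0 x).eq_or_lt with hφx | hφx
  · have : flux s p u φ (x, y) = 0 := by simp [flux, hφy, ← hφx]
    linarith
  have hxA : x ∈ A := by
    by_contra h
    exact hφx.ne' (hφA x h)
  have hux : k < u x := by
    by_contra! h
    have := hφu x
    rw [max_eq_right (by linarith)] at this
    linarith
  have hd : 0 ≤ ‖x - y‖ ^ ((n : ℝ) + s * p x y) := by positivity
  rcases le_total (u y) (u x) with h | h
  · have : 0 ≤ flux s p u φ (x, y) := by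
      unfold flux
      dsimp only
      rw [hφy, sub_zero]
      have := sub_nonneg.2 h
      positivity
    linarith
  · rw [tailDensity, indicator_of_mem (show (x, y) ∈ A ×ˢ Bᶜ from ⟨hxA, hy⟩)]
    unfold flux
    dsimp only
    rw [hφy, sub_zero, mul_div, ← neg_div]
    gcongr
    have e : |u x - u y| ^ (p x y - 2) * (u x - u y) = -(u y - u x) ^ (p x y - 1) := by
      rw [← abs_rpow_sub_two_mul_self h1 (sub_nonneg.2 h), abs_sub_comm]; ring
    rw [e, neg_mul, neg_le_neg_iff, mul_comm]
    have h2 : 0 ≤ u y - u x := sub_nonneg.2 h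
    gcongr
    · exact hφu x
    · exact le_max_of_le_left (by linarith)

lemma indicator_flux_le (hp : ExponentOK p) {A : Set (Rn n)} (hk : 0 ≤ k)
    (hφ0 : ∀ x, 0 ≤ φ x) (hφu : ∀ x, φ x ≤ max (u x - k) 0) (hφA : ∀ x, x ∉ A → φ x = 0)
    (hAB : A ⊆ B) (z : Rn n × Rn n) :
    (B ×ˢ B).indicator (flux s p u φ) z ≤
      flux s p u φ z + (tailDensity s p u A B k z + tailDensity s p u A B k z.swap) := by
  have h0 := tailDensity_nonneg (s := s) (p := p) (u := u) (B := B) (k := k) (A := A) z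
  have h1 := tailDensity_nonneg (s := s) (p := p) (u := u) (B := B) (k := k) (A := A) z.swap
  obtain ⟨x, y⟩ := z
  by_cases hz : (x, y) ∈ B ×ˢ B
  · rw [indicator_of_mem hz]; linarith
  rw [indicator_of_notMem hz]
  by_cases hy : y ∈ B
  · have hx : x ∉ B := fun hx => hz ⟨hx, hy⟩
    have := neg_tailDensity_le_flux (s := s) hp hk hφ0 hφu hφA hAB (x := y) hx
    have e := flux_swap (s := s) (u := u) (φ := φ) hp (x, y)
    simp only [Prod.swap_prod_mk] at e h1 ⊢
    linarith
  · have := neg_tailDensity_le_flux (s := s) hp hk hφ0 hφu hφA hAB (x := x) hy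
    linarith

lemma one_add_norm_rpow_le {x y : Rn n} {d Q e E : ℝ} (hd : 0 < d) (hd1 : d ≤ 1)
    (hxy : d / 2 ≤ ‖x - y‖) (hx : ‖x‖ ≤ Q) (he : 0 ≤ e) (heE : e ≤ E) :
    1 + ‖y‖ ^ e ≤ 2 * ((2 * Q + 2) / d) ^ E * ‖x - y‖ ^ e := by
  have hQ : 0 ≤ Q := (norm_nonneg x).trans hx
  have hΛ : 1 ≤ (2 * Q + 2) / d := by rw [one_le_div hd]; linarith
  have h1 : 1 ≤ (2 * Q + 2) / d * ‖x - y‖ := by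
    calc (1 : ℝ) ≤ (2 * Q + 2) / d * (d / 2) := by
          field_simp; linarith
      _ ≤ _ := by gcongr
  have h2 : ‖y‖ ≤ (2 * Q + 2) / d * ‖x - y‖ := by
    have h3 : ‖y‖ ≤ ‖x‖ + ‖x - y‖ := by
      have := norm_sub_le x (x - y)
      rwa [sub_sub_cancel] at this
    have h4 : Q ≤ 2 * Q / d * ‖x - y‖ := by
      calc Q = 2 * Q / d * (d / 2) := by field_simp
        _ ≤ _ := by gcongr
    have h5 : ‖x - y‖ ≤ 2 / d * ‖x - y‖ := by
      refine le_mul_of_one_le_left (norm_nonneg _) ?_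
      rw [one_le_div hd]; linarith
    calc ‖y‖ ≤ 2 * Q / d * ‖x - y‖ + 2 / d * ‖x - y‖ := by linarith
      _ = _ := by ring
  calc 1 + ‖y‖ ^ e ≤ ((2 * Q + 2) / d * ‖x - y‖) ^ e + ((2 * Q + 2) / d * ‖x - y‖) ^ e := by
        gcongr
        exact Real.one_le_rpow h1 he
    _ = 2 * ((2 * Q + 2) / d) ^ e * ‖x - y‖ ^ e := by
        rw [Real.mul_rpow (by positivity) (norm_nonneg _)]; ring
    _ ≤ _ := by gcongr

lemma lintegral_tailDensity_le (hs : s ∈ Ioo (0 : ℝ) 1) (hp : ExponentOK p) (hu : Measurable u)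
    {A : Set (Rn n)} {d Q M pM : ℝ}
    (hA : MeasurableSet A) (hB : MeasurableSet B) (hAB : A ⊆ B) (hd : 0 < d) (hd1 : d ≤ 1)
    (hAd : ∀ x ∈ A, ∀ y, y ∉ B → d / 2 ≤ ‖x - y‖) (hAQ : ∀ x ∈ A, ‖x‖ ≤ Q)
    (hpM : ∀ x y, p x y ≤ pM) (hP : 1 ≤ P)
    (htail : ∀ x ∈ A, ∫⁻ y, ENNReal.ofReal ((max (u y) 0) ^ (p x y - 1) /
      (1 + ‖y‖ ^ ((n : ℝ) + s * p x y))) ≤ ENNReal.ofReal M) :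
    ∫⁻ z, ENNReal.ofReal (tailDensity s p u A B k z) ≤
      ENNReal.ofReal (2 * ((2 * Q + 2) / d) ^ ((n : ℝ) + pM)) * ENNReal.ofReal M *
        ∫⁻ x, ENNReal.ofReal (excess u B k P x) := by
  have hm := (measurable_tailDensity (s := s) (k := k) hp hu hA hB).ennreal_ofReal
  rw [Measure.volume_eq_prod, lintegral_prod _ hm.aemeasurable,
    ← lintegral_const_mul _ (measurable_excess hu hB).ennreal_ofReal]
  refine lintegral_mono fun x => ?_
  by_cases hx : x ∈ A
  swap
  · have : ∀ y, tailDensity s p u A B k (x, y) = 0 := fun y =>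
      indicator_of_notMem (fun h => hx h.1) _
    simp [this]
  have hpx : Measurable fun y => p x y := hp.measurable.comp measurable_prodMk_left
  have hQ : 0 ≤ Q := (norm_nonneg x).trans (hAQ x hx)
  set Λ := 2 * ((2 * Q + 2) / d) ^ ((n : ℝ) + pM)
  have hΛ : 0 ≤ Λ := by positivity
  have hwe : max (u x - k) 0 ≤ excess u B k P x := by
    have := truncation_rpow_le_excess (u := u) (k := k) one_pos hP (hAB hx)
    rwa [Real.rpow_one] at this
  calc ∫⁻ y, ENNReal.ofReal (tailDensity s p u A B k (x, y))
      ≤ ∫⁻ y, ENNReal.ofReal (excess u B k P x * Λ) * ENNReal.ofReal ((max (u y) 0) ^ (p x y - 1) /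
          (1 + ‖y‖ ^ ((n : ℝ) + s * p x y))) := by
        refine lintegral_mono fun y => ?_
        rw [← ENNReal.ofReal_mul (mul_nonneg (excess_nonneg _) hΛ)]
        refine ENNReal.ofReal_le_ofReal ?_
        by_cases hy : y ∈ B
        · rw [tailDensity, indicator_of_notMem (fun h => h.2 hy)]
          have := excess_nonneg (u := u) (B := B) (k := k) (P := P) x
          positivity
        rw [tailDensity, indicator_of_mem (show (x, y) ∈ A ×ˢ Bᶜ from ⟨hx, hy⟩)]
        dsimp only
        have hpos : 0 < p x y := by linarith [hp.one_lt x y]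
        have h := one_add_norm_rpow_le (E := (n : ℝ) + pM) hd hd1 (hAd x hx y hy) (hAQ x hx)
          (by have := hs.1; positivity : 0 ≤ (n : ℝ) + s * p x y)
          (by nlinarith [hpM x y, hs.2])
        have hxy : 0 < ‖x - y‖ := lt_of_lt_of_le (by positivity) (hAd x hx y hy)
        rw [mul_assoc]
        refine mul_le_mul hwe ?_ (by positivity) (excess_nonneg _)
        rw [mul_div, div_le_div_iff₀ (by positivity) (by positivity)]
        calc _ ≤ max (u y) 0 ^ (p x y - 1) * (Λ * ‖x - y‖ ^ ((n : ℝ) + s * p x y)) := by gcongr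
          _ = _ := by ring
    _ = ENNReal.ofReal (excess u B k P x * Λ) * ∫⁻ y, ENNReal.ofReal ((max (u y) 0) ^ (p x y - 1) /
          (1 + ‖y‖ ^ ((n : ℝ) + s * p x y))) :=
        lintegral_const_mul _ (((hu.max measurable_const).pow (hpx.sub_const 1)).div
          (measurable_const.add (measurable_norm.pow (by fun_prop)))).ennreal_ofReal
    _ ≤ ENNReal.ofReal (excess u B k P x * Λ) * ENNReal.ofReal M := by
        gcongr
        exact htail x hx
    _ = _ := by
        rw [ENNReal.ofReal_mul (excess_nonneg _)]; ring

end

section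

variable {n : ℕ} {s : ℝ} {p : Rn n → Rn n → ℝ} {u ζ : Rn n → ℝ} {A B Ω : Set (Rn n)} {x₀ : Rn n}
  {k P r' g L pm pM : ℝ}

lemma truncation_mul_rpow_div_le (hs : s ∈ Ioo (0 : ℝ) 1) (hpm : 0 < pm) {q D : ℝ} {x : Rn n}
    {z : Rn n} (hx : x ∈ B) (hz : ‖z‖ ≤ 1) (hL : 1 ≤ L) (hq : pm ≤ q) (hqM : q ≤ pM) (hqP : q ≤ P)
    (hD : 0 ≤ D) (hDL : D ≤ L * ‖z‖) :
    (max (u x - k) 0 * D) ^ q / ‖z‖ ^ ((n : ℝ) + s * q) ≤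
      L ^ pM * (excess u B k P x * kern n s pm z) := by
  have hq0 : 0 < q := hpm.trans_le hq
  have hw : 0 ≤ max (u x - k) 0 := le_max_right _ _
  have h1 := min_rpow_div_le_kern hs hpm hq z
  rw [min_eq_right hz] at h1
  calc (max (u x - k) 0 * D) ^ q / ‖z‖ ^ ((n : ℝ) + s * q)
      ≤ (max (u x - k) 0 * (L * ‖z‖)) ^ q / ‖z‖ ^ ((n : ℝ) + s * q) := by gcongr
    _ = L ^ q * (max (u x - k) 0 ^ q * (‖z‖ ^ q / ‖z‖ ^ ((n : ℝ) + s * q))) := by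
        rw [Real.mul_rpow hw (by positivity), Real.mul_rpow (by positivity) (norm_nonneg _)]
        ring
    _ ≤ _ := by
        have := kern_nonneg s pm z
        have := excess_nonneg (u := u) (B := B) (k := k) (P := P) x
        gcongr
        exact truncation_rpow_le_excess hq0 hqP hx

lemma abs_truncation_mul_sub_le {N : ℝ} (hN : 0 ≤ N) (hζ0 : ∀ x, 0 ≤ ζ x) (hζ1 : ∀ x, ζ x ≤ 1)
    (x y : Rn n) :
    |min (max (u x - k) 0) N * ζ x - min (max (u y - k) 0) N * ζ y| ≤
      |u x - u y| + max (u y - k) 0 * |ζ x - ζ y| := by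
  have h1 : |min (max (u x - k) 0) N - min (max (u y - k) 0) N| ≤ |u x - u y| := by
    refine (abs_min_sub_min_le_max _ _ _ _).trans (max_le ?_ (by simp))
    refine (abs_max_sub_max_le_max _ _ _ _).trans (max_le ?_ (by simp))
    rw [sub_sub_sub_cancel_right]
  have h2 : 0 ≤ min (max (u y - k) 0) N := le_min (le_max_right _ _) hN
  calc _ = |(min (max (u x - k) 0) N - min (max (u y - k) 0) N) * ζ x +
        min (max (u y - k) 0) N * (ζ x - ζ y)| := by ring_nf
    _ ≤ |min (max (u x - k) 0) N - min (max (u y - k) 0) N| * ζ x +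
        min (max (u y - k) 0) N * |ζ x - ζ y| := by
        refine (abs_add_le _ _).trans_eq ?_
        rw [abs_mul, abs_mul, abs_of_nonneg (hζ0 x), abs_of_nonneg h2]
    _ ≤ |u x - u y| * 1 + max (u y - k) 0 * |ζ x - ζ y| := by
        gcongr
        · exact hζ0 x
        · exact hζ1 x
        · exact min_le_left _ _
    _ = _ := by rw [mul_one]

lemma gagliardo_truncation_mul_le_excess (hs : s ∈ Ioo (0 : ℝ) 1) (hpm : 1 < pm)
    (hpM : ∀ x y, pm ≤ p x y ∧ p x y ≤ pM) (hP : ∀ x ∈ B, ∀ y ∈ B, p x y ≤ P) (hL : 1 ≤ L)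
    (hζ0 : ∀ x, 0 ≤ ζ x) (hζ1 : ∀ x, ζ x ≤ 1) (hζL : ∀ x y, |ζ x - ζ y| ≤ L * ‖x - y‖)
    (hBd : ∀ x ∈ B, ∀ y ∈ B, ‖x - y‖ ≤ 1) {N : ℝ} (hN : 0 ≤ N) {z : Rn n × Rn n}
    (hz : z ∈ B ×ˢ B) :
    gagliardo s p (fun x => min (max (u x - k) 0) N * ζ x) z ≤
      2 ^ pM * (gagliardo s p u z +
        L ^ pM * (excess u B k P z.2 * kern n s pm (z.1 - z.2))) := by
  obtain ⟨x, y⟩ := z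
  obtain ⟨hx, hy⟩ := hz
  dsimp only at hx hy
  have hq : 0 < p x y := by linarith [(hpM x y).1]
  have h := truncation_mul_rpow_div_le (u := u) (k := k) hs (by linarith : 0 < pm) hy (hBd x hx y hy)
    hL (hpM x y).1 (hpM x y).2 (hP x hx y hy) (abs_nonneg _) (hζL x y)
  have hw : 0 ≤ max (u y - k) 0 * |ζ x - ζ y| := by positivity
  unfold gagliardo
  dsimp only
  calc _ ≤ 2 ^ p x y * (|u x - u y| ^ p x y + (max (u y - k) 0 * |ζ x - ζ y|) ^ p x y) /
        ‖x - y‖ ^ ((n : ℝ) + s * p x y) := by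
        gcongr
        refine le_trans ?_ (add_rpow_le_two_rpow_mul hq.le (abs_nonneg _) hw)
        gcongr
        exact abs_truncation_mul_sub_le hN hζ0 hζ1 x y
    _ = 2 ^ p x y * (|u x - u y| ^ p x y / ‖x - y‖ ^ ((n : ℝ) + s * p x y) +
        (max (u y - k) 0 * |ζ x - ζ y|) ^ p x y / ‖x - y‖ ^ ((n : ℝ) + s * p x y)) := by ring
    _ ≤ _ := by
        gcongr
        · exact one_le_two
        · exact (hpM x y).2

lemma lintegral_excess_fst_mul_kern (hu : Measurable u) (hB : MeasurableSet B) :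
    ∫⁻ z : Rn n × Rn n, ENNReal.ofReal (excess u B k P z.1 * kern n s pm (z.1 - z.2)) =
      (∫⁻ x, ENNReal.ofReal (excess u B k P x)) * ∫⁻ x, ENNReal.ofReal (kern n s pm x) := by
  rw [← lintegral_fst_mul_kern s pm (measurable_excess hu hB).ennreal_ofReal]
  exact lintegral_congr fun z => ENNReal.ofReal_mul (excess_nonneg _)

lemma lintegral_excess_snd_mul_kern (hu : Measurable u) (hB : MeasurableSet B) :
    ∫⁻ z : Rn n × Rn n, ENNReal.ofReal (excess u B k P z.2 * kern n s pm (z.1 - z.2)) =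
      (∫⁻ x, ENNReal.ofReal (excess u B k P x)) * ∫⁻ x, ENNReal.ofReal (kern n s pm x) := by
  rw [← lintegral_snd_mul_kern s pm (measurable_excess hu hB).ennreal_ofReal]
  exact lintegral_congr fun z => ENNReal.ofReal_mul (excess_nonneg _)

lemma integrable_excess_mul_kern (hn : 1 ≤ n) (hs : s ∈ Ioo (0 : ℝ) 1) (hpm : 0 < pm)
    (hu : Measurable u) (hB : MeasurableSet B)
    (hexc : ∫⁻ x, ENNReal.ofReal (excess u B k P x) < ⊤) :
    Integrable (fun z : Rn n × Rn n => excess u B k P z.1 * kern n s pm (z.1 - z.2)) ∧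
      Integrable (fun z : Rn n × Rn n => excess u B k P z.2 * kern n s pm (z.1 - z.2)) := by
  have hm := measurable_excess (k := k) (P := P) hu hB
  have hk : Measurable fun z : Rn n × Rn n => kern n s pm (z.1 - z.2) :=
    (measurable_kern n s pm).comp (measurable_fst.sub measurable_snd)
  have hfin := ENNReal.mul_lt_top hexc (lintegral_kern_lt_top hn hs hpm)
  refine ⟨⟨((hm.comp measurable_fst).mul hk).aestronglyMeasurable, ?_⟩,
    ⟨((hm.comp measurable_snd).mul hk).aestronglyMeasurable, ?_⟩⟩
  · rw [hasFiniteIntegral_iff_ofReal (Eventually.of_forall fun z =>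
      mul_nonneg (excess_nonneg _) (kern_nonneg _ _ _)), lintegral_excess_fst_mul_kern hu hB]
    exact hfin
  · rw [hasFiniteIntegral_iff_ofReal (Eventually.of_forall fun z =>
      mul_nonneg (excess_nonneg _) (kern_nonneg _ _ _)), lintegral_excess_snd_mul_kern hu hB]
    exact hfin

lemma integral_indicator_flux_le (hn : 1 ≤ n) (hs : s ∈ Ioo (0 : ℝ) 1) (hp : ExponentOK p)
    (hpm : 1 < pm) (hpM : ∀ x y, pm ≤ p x y ∧ p x y ≤ pM) (hP : ∀ x ∈ B, ∀ y ∈ B, p x y ≤ P)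
    (hu : MemW s p u) (hsub : IsWeakSubsol s p Ω u) (hk : 0 ≤ k) (hL : 1 ≤ L)
    (hζm : Measurable ζ) (hζ0 : ∀ x, 0 ≤ ζ x) (hζ1 : ∀ x, ζ x ≤ 1)
    (hζL : ∀ x y, |ζ x - ζ y| ≤ L * ‖x - y‖) (hζA : ∀ x, x ∉ A → ζ x = 0)
    (hB : MeasurableSet B) (hAB : A ⊆ B) (hBΩ : B ⊆ Ω)
    (hBv : volume B < ⊤) (hBd : ∀ x ∈ B, ∀ y ∈ B, ‖x - y‖ ≤ 1)
    (hexc : ∫⁻ x, ENNReal.ofReal (excess u B k P x) < ⊤)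
    (htd : Integrable (tailDensity s p u A B k)) :
    Integrable ((B ×ˢ B).indicator (flux s p u fun x => max (u x - k) 0 * ζ x)) ∧
      ∫ z, (B ×ˢ B).indicator (flux s p u fun x => max (u x - k) 0 * ζ x) z ≤
        2 * ∫ z, tailDensity s p u A B k z := by
  have hζB : ∀ x, x ∉ B → ζ x = 0 := fun x hx => hζA x fun h => hx (hAB h)
  set φ : ℕ → Rn n → ℝ := fun N x => min (max (u x - k) 0) N * ζ x with hφ
  have hφW : ∀ N, MemW s p (φ N) := fun N => memW_truncation_mul hn hs hp hu hk N.cast_nonneg hL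
    hζm hζ0 hζ1 hζL hζB hB hBv
  have hφ0 : ∀ N x, 0 ≤ φ N x := fun N x =>
    mul_nonneg (le_min (le_max_right _ _) N.cast_nonneg) (hζ0 x)
  have hBB := hB.prod hB
  set dom : Rn n × Rn n → ℝ := fun z => gagliardo s p u z + 2 ^ pM * (gagliardo s p u z +
    L ^ pM * (excess u B k P z.2 * kern n s pm (z.1 - z.2))) with hdom
  have hdom_int : Integrable dom :=
    (hu.integrable_gagliardo hp).add (((hu.integrable_gagliardo hp).add
      ((integrable_excess_mul_kern hn hs (by linarith) hu.1 hB hexc).2.const_mul _)).const_mul _)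
  have hdom_nonneg : ∀ z, 0 ≤ dom z := fun z => by
    have h1 := gagliardo_nonneg (s := s) (p := p) (u := u) z
    have h2 := excess_nonneg (u := u) (B := B) (k := k) (P := P) z.2
    have h3 := kern_nonneg s pm (z.1 - z.2)
    positivity
  have hle : ∀ N, ∀ᵐ z, ‖(B ×ˢ B).indicator (flux s p u (φ N)) z‖ ≤ dom z := fun N => by
    refine Eventually.of_forall fun z => ?_
    by_cases hz : z ∈ B ×ˢ B
    · rw [indicator_of_mem hz, Real.norm_eq_abs]
      refine (abs_flux_le (hp.one_lt _ _)).trans (add_le_add_right ?_ _)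
      exact gagliardo_truncation_mul_le_excess hs hpm hpM hP hL hζ0 hζ1 hζL hBd N.cast_nonneg hz
    · rw [indicator_of_notMem hz, norm_zero]; exact hdom_nonneg z
  have hmeas : ∀ N, AEStronglyMeasurable ((B ×ˢ B).indicator (flux s p u (φ N))) := fun N =>
    ((measurable_flux hp hu.1 (hφW N).1).indicator hBB).aestronglyMeasurable
  have hlim : ∀ᵐ z, Tendsto (fun N => (B ×ˢ B).indicator (flux s p u (φ N)) z) atTop
      (𝓝 ((B ×ˢ B).indicator (flux s p u fun x => max (u x - k) 0 * ζ x) z)) := by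
    refine Eventually.of_forall fun z => tendsto_const_nhds.congr' ?_
    filter_upwards [eventually_ge_atTop ⌈max (u z.1 - k) 0⌉₊,
      eventually_ge_atTop ⌈max (u z.2 - k) 0⌉₊] with N h1 h2
    simp only [indicator, flux, hφ, min_eq_left (Nat.ceil_le.1 h1), min_eq_left (Nat.ceil_le.1 h2)]
  refine ⟨hdom_int.mono' (aestronglyMeasurable_of_tendsto_ae atTop hmeas hlim) ?_, ?_⟩
  · filter_upwards [hlim, ae_all_iff.2 hle] with z h1 h2
    exact le_of_tendsto' h1.norm h2
  refine le_of_tendsto' (tendsto_integral_of_dominated_convergence dom hmeas hdom_int hle hlim)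
    fun N => ?_
  have hsw : Integrable fun z : Rn n × Rn n => tailDensity s p u A B k z.swap := htd.swap
  have hsw' : ∫ z : Rn n × Rn n, tailDensity s p u A B k z.swap = ∫ z, tailDensity s p u A B k z :=
    integral_prod_swap (μ := (volume : Measure (Rn n))) (ν := (volume : Measure (Rn n))) _
  have hfl := integrable_flux hp hu (hφW N)
  have h0 := hsub.integral_flux_nonpos hp hu (hφW N) (hφ0 N) fun x hx => by
    simp [hφ, hζB x fun h => hx (hBΩ h)]
  calc ∫ z, (B ×ˢ B).indicator (flux s p u (φ N)) z
      ≤ ∫ z, (flux s p u (φ N) z +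
          (tailDensity s p u A B k z + tailDensity s p u A B k z.swap)) := by
        refine integral_mono (hfl.indicator hBB) (hfl.add (htd.add hsw)) fun z => ?_
        refine indicator_flux_le hp hk (hφ0 N) (fun x => ?_) (fun x hx => ?_) hAB z
        · calc φ N x ≤ max (u x - k) 0 * 1 := by
                simp only [hφ]
                gcongr
                · exact hζ0 x
                · exact min_le_left _ _
                · exact hζ1 x
            _ = _ := mul_one _
        · simp [hφ, hζA x hx]
    _ ≤ _ := by
        rw [integral_add hfl, integral_add htd hsw, hsw']
        · linarith
        · exact htd.add hsw

end

/-- The part of the energy coming from pairs separated by the level `k`. -/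
def interaction {n : ℕ} (s : ℝ) (p : Rn n → Rn n → ℝ) (u : Rn n → ℝ) (A B : Set (Rn n)) (k : ℝ)
    (z : Rn n × Rn n) : ℝ :=
  (({x | k < u x} ∩ A) ×ˢ ({x | u x ≤ k} ∩ B)).indicator
    (fun z => max (u z.1 - k) 0 ^ p z.1 z.2 / ‖z.1 - z.2‖ ^ ((n : ℝ) + s * p z.1 z.2)) z

section

variable {n : ℕ} {s : ℝ} {p : Rn n → Rn n → ℝ} {u : Rn n → ℝ} {A B Ω : Set (Rn n)} {x₀ : Rn n}
  {k P r r' g pm pM : ℝ}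

lemma interaction_nonneg (z : Rn n × Rn n) : 0 ≤ interaction s p u A B k z :=
  indicator_nonneg (fun _ _ => by positivity) z

lemma measurable_interaction (hp : ExponentOK p) (hu : Measurable u)
    (hA : MeasurableSet A) (hB : MeasurableSet B) :
    Measurable (interaction s p u A B k) := by
  have := hp.measurable
  have h1 : Measurable fun z : Rn n × Rn n => u z.1 := hu.comp measurable_fst
  refine Measurable.indicator ?_ (((measurableSet_lt measurable_const hu).inter hA).prod
    ((measurableSet_le hu measurable_const).inter hB))
  exact (((h1.sub_const k).max measurable_const).pow this).div
      ((measurable_fst.sub measurable_snd).norm.pow (by fun_prop))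

lemma interaction_le (hs : s ∈ Ioo (0 : ℝ) 1) (hpm : 1 < pm)
    (hpM : ∀ x y, pm ≤ p x y ∧ p x y ≤ pM) (hP : ∀ x ∈ B, ∀ y ∈ B, p x y ≤ P)
    (hg : 0 < g) {m : ℕ} (hm : pM ≤ m) (hL : 1 ≤ 2 * m / g)
    (hAB : ball x₀ r' ⊆ B) (hBd : ∀ x ∈ B, ∀ y ∈ B, ‖x - y‖ ≤ 1) (z : Rn n × Rn n) :
    interaction s p u (ball x₀ r') B k z ≤
      (B ×ˢ B).indicator (flux s p u fun x => max (u x - k) 0 * cutoff x₀ r' g x ^ m) z +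
        (2 * m / g) ^ pM * (excess u B k P z.1 * kern n s pm (z.1 - z.2) +
          excess u B k P z.2 * kern n s pm (z.1 - z.2)) := by
  obtain ⟨x, y⟩ := z
  have hK := kern_nonneg s pm (x - y)
  have hEx := excess_nonneg (u := u) (B := B) (k := k) (P := P) x
  have hEy := excess_nonneg (u := u) (B := B) (k := k) (P := P) y
  have herr : 0 ≤ (2 * m / g) ^ pM * (excess u B k P x * kern n s pm (x - y) +
      excess u B k P y * kern n s pm (x - y)) := by positivity
  by_cases hz : (x, y) ∈ B ×ˢ B
  swap
  · rw [indicator_of_notMem hz, zero_add, interaction, indicator_of_notMem]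
    · exact herr
    · exact fun h => hz ⟨hAB h.1.2, h.2.2⟩
  obtain ⟨hx, hy⟩ := id hz
  dsimp only at hx hy
  have hp1 : 1 < p x y := hpm.trans_le (hpM x y).1
  have hd : 0 ≤ ‖x - y‖ ^ ((n : ℝ) + s * p x y) := by positivity
  rw [indicator_of_mem hz]
  by_cases hxy : (x, y) ∈ ({x | k < u x} ∩ ball x₀ r') ×ˢ ({x | u x ≤ k} ∩ B)
  · rw [interaction, indicator_of_mem hxy]
    refine le_add_of_le_of_nonneg ?_ herr
    obtain ⟨⟨h1, h2⟩, h3, -⟩ := hxy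
    dsimp only [mem_ofPred_eq] at h1 h2 h3
    unfold flux
    dsimp only
    gcongr
    have := truncation_flux_lower_of_le (m := m) (θ := cutoff x₀ r' g y) hp1
      (cutoff_nonneg (x₀ := x₀) (r' := r') (g := g) x) h1 h3
    simpa only [cutoff_eq_one hg h2, one_pow, mul_one] using this
  · rw [interaction, indicator_of_notMem hxy]
    have hD : 0 ≤ m * |cutoff x₀ r' g x - cutoff x₀ r' g y| := by positivity
    have hDL : m * |cutoff x₀ r' g x - cutoff x₀ r' g y| ≤ 2 * m / g * ‖x - y‖ := by
      calc m * |cutoff x₀ r' g x - cutoff x₀ r' g y| ≤ m * (2 / g * ‖x - y‖) := by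
            gcongr
            exact abs_cutoff_sub_le hg x y
        _ = _ := by ring
    have h1 := truncation_mul_rpow_div_le (u := u) (k := k) hs (by linarith) hx (hBd x hx y hy) hL
      (hpM x y).1 (hpM x y).2 (hP x hx y hy) hD hDL
    have h2 := truncation_mul_rpow_div_le (u := u) (k := k) hs (by linarith) hy (hBd x hx y hy) hL
      (hpM x y).1 (hpM x y).2 (hP x hx y hy) hD hDL
    have h3 := div_le_div_of_nonneg_right (truncation_flux_lower (a := u x) (b := u y) (k := k)
      (θ := cutoff x₀ r' g y) hp1 ((hpM x y).2.trans hm) (cutoff_nonneg (x₀ := x₀) (r' := r') (g := g) x) (cutoff_le_one x)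
      (cutoff_nonneg y) (cutoff_le_one y)) hd
    rw [neg_div, add_div] at h3
    unfold flux
    dsimp only
    rw [← mul_assoc, mul_comm _ (m : ℝ)] at h1 h2
    linarith

/-- A Caccioppoli-type estimate. -/
lemma lintegral_interaction_le (hn : 1 ≤ n) (hs : s ∈ Ioo (0 : ℝ) 1) (hp : ExponentOK p)
    (hpm : 1 < pm) (hpM : ∀ x y, pm ≤ p x y ∧ p x y ≤ pM) (hP : ∀ x ∈ B, ∀ y ∈ B, p x y ≤ P)
    (hu : MemW s p u) (hsub : IsWeakSubsol s p Ω u) (hk : 0 ≤ k)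
    (hg : 0 < g) {m : ℕ} (hm : pM ≤ m) (hL : 1 ≤ 2 * m / g) (hm0 : m ≠ 0)
    (hB : MeasurableSet B) (hAB : ball x₀ (r' + g / 2) ⊆ B) (hBΩ : B ⊆ Ω)
    (hBv : volume B < ⊤) (hBd : ∀ x ∈ B, ∀ y ∈ B, ‖x - y‖ ≤ 1)
    (hexc : ∫⁻ x, ENNReal.ofReal (excess u B k P x) < ⊤)
    (htd : ∫⁻ z, ENNReal.ofReal (tailDensity s p u (ball x₀ (r' + g / 2)) B k z) < ⊤) :
    ∫⁻ z, ENNReal.ofReal (interaction s p u (ball x₀ r') B k z) ≤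
      2 * (∫⁻ z, ENNReal.ofReal (tailDensity s p u (ball x₀ (r' + g / 2)) B k z)) +
        2 * ENNReal.ofReal ((2 * m / g) ^ pM) * ((∫⁻ x, ENNReal.ofReal (excess u B k P x)) *
          ∫⁻ x, ENNReal.ofReal (kern n s pm x)) := by
  have hum := hu.1
  set td := tailDensity s p u (ball x₀ (r' + g / 2)) B k with htd_def
  have htd0 : ∀ z, 0 ≤ td z := fun z => tailDensity_nonneg z
  have htdi : Integrable td := ⟨(measurable_tailDensity hp hum measurableSet_ball
    hB).aestronglyMeasurable, by
      rwa [hasFiniteIntegral_iff_ofReal (Eventually.of_forall htd0)]⟩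
  have hAB' : ball x₀ r' ⊆ B := (ball_subset_ball (by linarith)).trans hAB
  obtain ⟨hI, hIle⟩ := integral_indicator_flux_le (ζ := fun x => cutoff x₀ r' g x ^ m) hn hs hp hpm
    hpM hP hu hsub hk hL (continuous_cutoff.measurable.pow_const m)
    (fun x => pow_nonneg (cutoff_nonneg x) m)
    (fun x => pow_le_one₀ (cutoff_nonneg x) (cutoff_le_one x)) (abs_cutoff_pow_sub_le hg m)
    (fun x hx => by rw [cutoff_eq_zero hg hx, zero_pow hm0])
    hB hAB hBΩ hBv hBd hexc htdi
  obtain ⟨h1, h2⟩ := integrable_excess_mul_kern hn hs (by linarith : 0 < pm) hum hB hexc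
  have herr := (h1.add h2).const_mul ((2 * m / g) ^ pM)
  have hle := interaction_le (u := u) (k := k) hs hpm hpM hP hg hm hL hAB' hBd
  have hint : Integrable (interaction s p u (ball x₀ r') B k) :=
    (hI.add herr).mono' (measurable_interaction hp hum measurableSet_ball hB).aestronglyMeasurable
      (Eventually.of_forall fun z => by
        rw [Real.norm_of_nonneg (interaction_nonneg z)]; exact hle z)
  have h1' : ENNReal.ofReal (∫ z : Rn n × Rn n, excess u B k P z.1 * kern n s pm (z.1 - z.2)) =
      (∫⁻ x, ENNReal.ofReal (excess u B k P x)) * ∫⁻ x, ENNReal.ofReal (kern n s pm x) := by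
    rw [ofReal_integral_eq_lintegral_ofReal h1 (Eventually.of_forall fun z =>
      mul_nonneg (excess_nonneg _) (kern_nonneg _ _ _)), lintegral_excess_fst_mul_kern hum hB]
  have h2' : ENNReal.ofReal (∫ z : Rn n × Rn n, excess u B k P z.2 * kern n s pm (z.1 - z.2)) =
      (∫⁻ x, ENNReal.ofReal (excess u B k P x)) * ∫⁻ x, ENNReal.ofReal (kern n s pm x) := by
    rw [ofReal_integral_eq_lintegral_ofReal h2 (Eventually.of_forall fun z =>
      mul_nonneg (excess_nonneg _) (kern_nonneg _ _ _)), lintegral_excess_snd_mul_kern hum hB]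
  have hmain : ∫ z, interaction s p u (ball x₀ r') B k z ≤ 2 * (∫ z, td z) + (2 * m / g) ^ pM *
      ((∫ z : Rn n × Rn n, excess u B k P z.1 * kern n s pm (z.1 - z.2)) +
        ∫ z : Rn n × Rn n, excess u B k P z.2 * kern n s pm (z.1 - z.2)) := by
    calc _ ≤ _ := integral_mono hint (hI.add herr) hle
      _ = _ := integral_add hI herr
      _ ≤ _ := by
        refine add_le_add hIle (le_of_eq ?_)
        rw [integral_const_mul]
        congr 1
        exact integral_add h1 h2
  rw [← ofReal_integral_eq_lintegral_ofReal hint (Eventually.of_forall interaction_nonneg),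
    ← ofReal_integral_eq_lintegral_ofReal htdi (Eventually.of_forall htd0)]
  refine (ENNReal.ofReal_le_ofReal hmain).trans ?_
  have i1 : 0 ≤ ∫ z, td z := integral_nonneg htd0
  have i2 : 0 ≤ ∫ z : Rn n × Rn n, excess u B k P z.1 * kern n s pm (z.1 - z.2) :=
    integral_nonneg fun z => mul_nonneg (excess_nonneg _) (kern_nonneg _ _ _)
  have i3 : 0 ≤ ∫ z : Rn n × Rn n, excess u B k P z.2 * kern n s pm (z.1 - z.2) :=
    integral_nonneg fun z => mul_nonneg (excess_nonneg _) (kern_nonneg _ _ _)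
  rw [ENNReal.ofReal_add (by positivity) (by positivity), ENNReal.ofReal_mul zero_le_two,
    ENNReal.ofReal_mul (by positivity), ENNReal.ofReal_add i2 i3, h1', h2', ENNReal.ofReal_ofNat]
  refine le_of_eq ?_
  ring

/-- The Caccioppoli-type estimate on concentric balls, with the tail absorbed in the constant. -/
lemma exists_lintegral_interaction_le (hn : 1 ≤ n) (hs : s ∈ Ioo (0 : ℝ) 1) (hp : ExponentOK p)
    (hu : MemW s p u) (hsub : IsWeakSubsol s p Ω u) {R : ℝ} (hR : R ≤ 1 / 2)
    (hΩ : ball x₀ R ⊆ Ω) (hP1 : 1 ≤ P) (hP : ∀ x ∈ ball x₀ R, ∀ y ∈ ball x₀ R, p x y ≤ P) {M : ℝ}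
    (htail : ∀ x ∈ Ω, ∫⁻ y, ENNReal.ofReal ((max (u y) 0) ^ (p x y - 1) /
      (1 + ‖y‖ ^ ((n : ℝ) + s * p x y))) ≤ ENNReal.ofReal M)
    (hint : ∫⁻ x in ball x₀ R, ENNReal.ofReal (max (u x) 0 ^ P) < ⊤) :
    ∃ C β : ℝ, 0 < C ∧ 0 ≤ β ∧ ∀ k r' g : ℝ, 0 ≤ k → 0 < g → g ≤ 1 → r' + g ≤ R →
      ∫⁻ z, ENNReal.ofReal (interaction s p u (ball x₀ r') (ball x₀ (r' + g)) k z) ≤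
        ENNReal.ofReal (C * g ^ (-β)) *
          ∫⁻ x, ENNReal.ofReal (excess u (ball x₀ (r' + g)) k P x) := by
  obtain ⟨-, -, pm, pM, hpm, hpM⟩ := id hp
  have hpM1 : 1 < pM := by linarith [(hpM x₀ x₀).1, (hpM x₀ x₀).2]
  set Q : ℝ := ‖x₀‖ + 1
  have hQ : 0 < Q := by positivity
  obtain ⟨m, hm⟩ := exists_nat_ge pM
  have hm1 : (1 : ℝ) < m := by linarith
  have hm0 : m ≠ 0 := by rintro rfl; norm_num at hm1
  have hκ := lintegral_kern_lt_top (s := s) hn hs (by linarith : 0 < pm)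
  set κ := ∫⁻ x, ENNReal.ofReal (kern n s pm x)
  set β : ℝ := n + pM with hβ
  have hβ0 : 0 ≤ β := by positivity
  refine ⟨4 * (2 * Q + 2) ^ β * |M| + 2 * (2 * m) ^ pM * κ.toReal + 1, β, by positivity, hβ0,
    fun k r' g hk hg hg1 hr => ?_⟩
  have hBR : ball x₀ (r' + g) ⊆ ball x₀ R := ball_subset_ball hr
  have hAB : ball x₀ (r' + g / 2) ⊆ ball x₀ (r' + g) := ball_subset_ball (by linarith)
  have hexc : ∫⁻ x, ENNReal.ofReal (excess u (ball x₀ (r' + g)) k P x) < ⊤ :=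
    lintegral_excess_lt_top hk (by linarith) measurableSet_ball measure_ball_lt_top
      ((lintegral_mono_set hBR).trans_lt hint)
  have htd := lintegral_tailDensity_le (s := s) (A := ball x₀ (r' + g / 2)) (k := k) (P := P)
    (d := g) (Q := Q) (M := M) hs hp hu.1 measurableSet_ball (measurableSet_ball (x := x₀) (ε := r' + g))
    hAB hg hg1
    (fun x hx y hy => by
      rw [mem_ball] at hx hy
      rw [← dist_eq_norm]
      linarith [dist_triangle y x x₀, dist_comm x y])
    (fun x hx => by
      have h1 := hBR (hAB hx)
      rw [mem_ball, dist_eq_norm] at h1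
      have h2 := norm_add_le x₀ (x - x₀)
      rw [add_sub_cancel] at h2
      linarith) (fun x y => (hpM x y).2) hP1
    (fun x hx => htail x (hΩ (hBR (hAB hx))))
  have hL : 1 ≤ 2 * m / g := by rw [one_le_div hg]; linarith
  refine (lintegral_interaction_le hn hs hp hpm hpM (fun x hx y hy => hP x (hBR hx) y (hBR hy)) hu
    hsub hk hg hm hL hm0 measurableSet_ball hAB (hBR.trans hΩ) measure_ball_lt_top
    (fun x hx y hy => ?_) hexc (htd.trans_lt ?_)).trans ?_
  · have h1 := hBR hx
    have h2 := hBR hy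
    rw [mem_ball] at h1 h2
    rw [← dist_eq_norm]
    linarith [dist_triangle_right x y x₀]
  · exact ENNReal.mul_lt_top (ENNReal.mul_lt_top ENNReal.ofReal_lt_top ENNReal.ofReal_lt_top) hexc
  set X := ∫⁻ x, ENNReal.ofReal (excess u (ball x₀ (r' + g)) k P x)
  have hgβ : 0 < g ^ (-β) := by positivity
  have e1 : ((2 * Q + 2) / g) ^ β = (2 * Q + 2) ^ β * g ^ (-β) := by
    rw [Real.div_rpow (by positivity) hg.le, Real.rpow_neg hg.le, div_eq_mul_inv]
  have e2 : (2 * m / g) ^ pM ≤ (2 * m) ^ pM * g ^ (-β) := by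
    rw [Real.div_rpow (by positivity) hg.le, div_eq_mul_inv, ← Real.rpow_neg hg.le]
    gcongr ?_ * ?_
    exact Real.rpow_le_rpow_of_exponent_ge hg hg1 (by simp [hβ])
  calc _ ≤ 2 * (ENNReal.ofReal (2 * ((2 * Q + 2) ^ β * g ^ (-β))) * ENNReal.ofReal |M| * X) +
        2 * ENNReal.ofReal ((2 * m) ^ pM * g ^ (-β)) * (X * ENNReal.ofReal κ.toReal) := by
        rw [ENNReal.ofReal_toReal hκ.ne]
        gcongr
        refine htd.trans ?_
        rw [← hβ, e1]
        gcongr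
        exact le_abs_self M
    _ = ENNReal.ofReal (4 * (2 * Q + 2) ^ β * |M| * g ^ (-β) +
          2 * (2 * m) ^ pM * κ.toReal * g ^ (-β)) * X := by
        rw [ENNReal.ofReal_add (by positivity) (by positivity), add_mul,
          show (2 : ℝ≥0∞) = ENNReal.ofReal 2 by simp, mul_comm X, ← mul_assoc, ← mul_assoc,
          ← ENNReal.ofReal_mul (by positivity), ← ENNReal.ofReal_mul (by positivity),
          ← ENNReal.ofReal_mul (by positivity), ← mul_assoc _ _ X,
          ← ENNReal.ofReal_mul (by positivity)]
        congr 3 <;> ring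
    _ ≤ _ := by
        gcongr
        nlinarith

end

/-- The minimum of the powers `t ^ a` and `t ^ b`. -/
def minPow (a b t : ℝ) : ℝ := min (t ^ a) (t ^ b)

section

variable {a b t : ℝ}

lemma measurable_minPow : Measurable (minPow a b) := by
  unfold minPow
  fun_prop

lemma minPow_nonneg (ht : 0 ≤ t) : 0 ≤ minPow a b t :=
  le_min (Real.rpow_nonneg ht _) (Real.rpow_nonneg ht _)

lemma minPow_zero (ha : 0 < a) (hab : a ≤ b) : minPow a b 0 = 0 := by
  rw [minPow, Real.zero_rpow ha.ne', Real.zero_rpow (ha.trans_le hab).ne', min_self]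

lemma minPow_of_le_one (ha : 0 < a) (hab : a ≤ b) (ht : 0 ≤ t) (ht1 : t ≤ 1) :
    minPow a b t = t ^ b :=
  min_eq_right (Real.rpow_le_rpow_of_exponent_ge' ht ht1 ha.le hab)

lemma minPow_of_one_le (hab : a ≤ b) (ht1 : 1 ≤ t) : minPow a b t = t ^ a :=
  min_eq_left (Real.rpow_le_rpow_of_exponent_le ht1 hab)

lemma minPow_mono (ha : 0 ≤ a) (hb : 0 ≤ b) (ht : 0 ≤ t) {t' : ℝ} (h : t ≤ t') :
    minPow a b t ≤ minPow a b t' :=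
  min_le_min (Real.rpow_le_rpow ht h ha) (Real.rpow_le_rpow ht h hb)

lemma minPow_le_rpow (ha : 0 < a) {q : ℝ} (haq : a ≤ q) (hqb : q ≤ b) (ht : 0 ≤ t) :
    minPow a b t ≤ t ^ q := by
  rcases le_total t 1 with h | h
  · exact (min_le_right _ _).trans (Real.rpow_le_rpow_of_exponent_ge' ht h (ha.le.trans haq) hqb)
  · exact (min_le_left _ _).trans (Real.rpow_le_rpow_of_exponent_le h haq)

lemma rpow_le_minPow_add {q θ v : ℝ} (ha : 0 < a) (hq : 0 < q) (hθ : 0 ≤ θ) (hab : a ≤ b)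
    (hb : b = (1 - θ) * a + θ * q) (ht : 0 ≤ t) (htv : t ≤ v) :
    t ^ b ≤ minPow a b t + minPow a b t ^ (1 - θ) * (v ^ q) ^ θ := by
  have h0 := minPow_nonneg (a := a) (b := b) ht
  have hv : 0 ≤ v := ht.trans htv
  rcases le_total t 1 with h | h
  · rw [minPow_of_le_one ha hab ht h] at h0 ⊢
    exact le_add_of_nonneg_right (by positivity)
  · refine le_add_of_nonneg_of_le h0 ?_
    rw [minPow_of_one_le hab h, ← Real.rpow_mul ht, ← Real.rpow_mul hv, hb,
      Real.rpow_add (by linarith)]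
    rw [mul_comm a, mul_comm q]
    gcongr

end

section

variable {n : ℕ} {s : ℝ} {p : Rn n → Rn n → ℝ} {u : Rn n → ℝ} {x₀ : Rn n}
  {k P₁ P₂ r r' g ρ δ : ℝ}

lemma setLIntegral_minPow_le (hs : s ∈ Ioo (0 : ℝ) 1) (hp : ExponentOK p) (hu : Measurable u)
    (hP₁ : 0 < P₁) (hP : ∀ x ∈ ball x₀ (r' + g), ∀ y ∈ ball x₀ (r' + g), P₁ ≤ p x y ∧ p x y ≤ P₂)
    (hρ : 0 < ρ) (hρg : ρ ≤ g) (hρ1 : ρ ≤ 1)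
    (hhalf : 2 * volume ({x | k < u x} ∩ ball x₀ (r' + g)) ≤ volume (ball x₀ ρ)) :
    ∫⁻ x in ball x₀ r', ENNReal.ofReal (minPow P₁ P₂ (max (u x - k) 0)) ≤
      ENNReal.ofReal (ρ ^ (s * P₁)) * (2 / volume (ball (0 : Rn n) 1)) *
        ∫⁻ z, ENNReal.ofReal (interaction s p u (ball x₀ r') (ball x₀ (r' + g)) k z) := by
  have hg : 0 < g := hρ.trans_le hρg
  refine setLIntegral_le_of_interaction (E := {x | k < u x} ∩ ball x₀ (r' + g)) hρ
    measurableSet_ball ((measurableSet_lt measurable_const hu).inter measurableSet_ball)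
    (measurable_interaction hp hu measurableSet_ball measurableSet_ball).ennreal_ofReal
    (fun x _ => ?_) fun x hx y hy hyE => ?_
  · rw [volume_ball_eq x hρ, ← volume_ball_eq x₀ hρ]
    refine le_trans ?_ hhalf
    exact mul_le_mul' le_rfl (measure_mono inter_subset_left)
  · have hxB : x ∈ ball x₀ (r' + g) := ball_subset_ball (by linarith) hx
    have hyB : y ∈ ball x₀ (r' + g) := by
      rw [mem_ball] at hx hy ⊢
      linarith [dist_triangle y x x₀]
    have hyk : u y ≤ k := not_lt.1 fun h => hyE ⟨h, hyB⟩
    obtain ⟨h1, h2⟩ := hP x hxB y hyB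
    rcases le_or_gt (u x) k with hxk | hxk
    · rw [max_eq_right (by linarith), minPow_zero hP₁ (h1.trans h2)]
      simp
    have hw : 0 ≤ max (u x - k) 0 := le_max_right _ _
    rw [← ENNReal.ofReal_mul (minPow_nonneg hw)]
    refine ENNReal.ofReal_le_ofReal ?_
    rw [interaction, indicator_of_mem (show (x, y) ∈ ({x | k < u x} ∩ ball x₀ r') ×ˢ
      ({x | u x ≤ k} ∩ ball x₀ (r' + g)) from ⟨⟨hxk, hx⟩, hyk, hyB⟩)]
    have hxy : 0 < ‖x - y‖ := by
      rw [norm_pos_iff, sub_ne_zero]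
      rintro rfl
      linarith
    rw [Real.rpow_neg hρ.le, ← div_eq_mul_inv]
    have h3 : 0 ≤ s * (p x y - P₁) := mul_nonneg hs.1.le (by linarith)
    have h4 : 0 ≤ s * p x y := mul_nonneg hs.1.le (by linarith)
    refine div_le_div₀ (by positivity) (minPow_le_rpow hP₁ h1 h2 hw) (by positivity) ?_
    calc ‖x - y‖ ^ ((n : ℝ) + s * p x y) ≤ ρ ^ ((n : ℝ) + s * p x y) := by
          gcongr
          rw [← dist_eq_norm, dist_comm]
          exact (mem_ball.1 hy).le
      _ ≤ _ := Real.rpow_le_rpow_of_exponent_ge hρ hρ1 (by linarith)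

lemma ofReal_rpow_mul_volume_le (hu : Measurable u) (hP₁ : 0 < P₁) (hP : P₁ ≤ P₂) (hδ : 0 < δ)
    (hδ1 : δ ≤ 1) :
    ENNReal.ofReal (δ ^ P₂) * volume ({x | k + δ < u x} ∩ ball x₀ r) ≤
      ∫⁻ x in ball x₀ r, ENNReal.ofReal (minPow P₁ P₂ (max (u x - k) 0)) := by
  have hm : MeasurableSet ({x | k + δ < u x} ∩ ball x₀ r) :=
    (measurableSet_lt measurable_const hu).inter measurableSet_ball
  refine le_trans ?_ (lintegral_mono_set (inter_subset_right (s := {x | k + δ < u x})))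
  rw [← setLIntegral_const]
  refine setLIntegral_mono' hm fun x hx => ENNReal.ofReal_le_ofReal ?_
  rw [← minPow_of_le_one hP₁ hP hδ.le hδ1]
  refine minPow_mono hP₁.le (hP₁.le.trans hP) hδ.le (le_max_of_le_left ?_)
  have := hx.1
  rw [mem_ofPred_eq] at this
  linarith

lemma lintegral_excess_le {θ q : ℝ} (hu : Measurable u) (hP₁ : 0 < P₁) (hP : P₁ ≤ P₂) (hq : 0 < q)
    (hθ : θ ∈ Ioo (0 : ℝ) 1) (hP₂ : P₂ = (1 - θ) * P₁ + θ * q) (hk : 0 ≤ k) (hδ : 0 < δ)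
    (hδ1 : δ ≤ 1)
    (hY : ∫⁻ x in ball x₀ r, ENNReal.ofReal (minPow P₁ P₂ (max (u x - k) 0)) ≤ 1) :
    ∫⁻ x, ENNReal.ofReal (excess u (ball x₀ r) (k + δ) P₂ x) ≤
      ENNReal.ofReal (δ ^ (-P₂)) *
        (2 + (∫⁻ x in ball x₀ r, ENNReal.ofReal (max (u x) 0 ^ q)) ^ θ) *
        (∫⁻ x in ball x₀ r, ENNReal.ofReal (minPow P₁ P₂ (max (u x - k) 0))) ^ (1 - θ) := by
  set Y := ∫⁻ x in ball x₀ r, ENNReal.ofReal (minPow P₁ P₂ (max (u x - k) 0)) with hYdef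
  set N := ∫⁻ x in ball x₀ r, ENNReal.ofReal (max (u x) 0 ^ q) with hN
  have hθ1 : 0 < 1 - θ := by linarith [hθ.2]
  have hP₂0 : 0 < P₂ := hP₁.trans_le hP
  have hδP : 1 ≤ δ ^ (-P₂) := Real.one_le_rpow_of_pos_of_le_one_of_nonpos hδ hδ1 (by linarith)
  set G : Rn n → ℝ := fun x => minPow P₁ P₂ (max (u x - k) 0) with hG
  have hG0 : ∀ x, 0 ≤ G x := fun x => minPow_nonneg (le_max_right _ _)
  have hGm : Measurable G := measurable_minPow.comp ((hu.sub_const k).max measurable_const)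
  have hVm : Measurable fun x => max (u x) 0 ^ q := (hu.max measurable_const).pow_const q
  have hpt : ∀ x, excess u (ball x₀ r) (k + δ) P₂ x ≤ (ball x₀ r).indicator
      (fun x => (δ ^ (-P₂) + 1) * G x + G x ^ (1 - θ) * (max (u x) 0 ^ q) ^ θ) x := by
    intro x
    by_cases hx : x ∈ {x | k + δ < u x} ∩ ball x₀ r
    swap
    · rw [excess, indicator_of_notMem hx]
      refine indicator_nonneg (fun x _ => ?_) x
      have := hG0 x
      positivity
    rw [excess, indicator_of_mem hx, indicator_of_mem hx.2]
    have hx1 : k + δ < u x := hx.1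
    have hδw : δ ≤ max (u x - k) 0 := le_max_of_le_left (by linarith)
    have h1 : 1 ≤ δ ^ (-P₂) * G x := by
      calc (1 : ℝ) = δ ^ (-P₂) * minPow P₁ P₂ δ := by
            rw [minPow_of_le_one hP₁ hP hδ.le hδ1, ← Real.rpow_add hδ, neg_add_cancel,
              Real.rpow_zero]
        _ ≤ _ := by
            gcongr
            exact minPow_mono hP₁.le hP₂0.le hδ.le hδw
    have h2 : max (u x - (k + δ)) 0 ^ P₂ ≤ max (u x - k) 0 ^ P₂ := by
      gcongr
      linarith
    have h3 := rpow_le_minPow_add (v := max (u x) 0) hP₁ hq hθ.1.le hP hP₂ (le_max_right (u x - k) 0)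
      (max_le_max_right 0 (by linarith))
    change _ ≤ G x + G x ^ (1 - θ) * _ at h3
    linarith
  have hol : ∫⁻ x in ball x₀ r, ENNReal.ofReal (G x) ^ (1 - θ) *
      ENNReal.ofReal (max (u x) 0 ^ q) ^ θ ≤ Y ^ (1 - θ) * N ^ θ :=
    ENNReal.lintegral_mul_norm_pow_le hGm.ennreal_ofReal.aemeasurable
      hVm.ennreal_ofReal.aemeasurable hθ1.le hθ.1.le (by ring)
  calc _ ≤ ∫⁻ x in ball x₀ r, (ENNReal.ofReal (δ ^ (-P₂) + 1) * ENNReal.ofReal (G x) +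
        ENNReal.ofReal (G x) ^ (1 - θ) * ENNReal.ofReal (max (u x) 0 ^ q) ^ θ) := by
        rw [← lintegral_indicator measurableSet_ball]
        refine lintegral_mono fun x => (ENNReal.ofReal_le_ofReal (hpt x)).trans (le_of_eq ?_)
        by_cases hx : x ∈ ball x₀ r
        · have := hG0 x
          rw [indicator_of_mem hx, indicator_of_mem hx,
            ENNReal.ofReal_add (by positivity) (by positivity), ENNReal.ofReal_mul (by positivity),
            ENNReal.ofReal_mul (by positivity), ENNReal.ofReal_rpow_of_nonneg this hθ1.le,
            ENNReal.ofReal_rpow_of_nonneg (by positivity) hθ.1.le]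
        · rw [indicator_of_notMem hx, indicator_of_notMem hx, ENNReal.ofReal_zero]
    _ ≤ ENNReal.ofReal (δ ^ (-P₂) + 1) * Y + Y ^ (1 - θ) * N ^ θ := by
        rw [lintegral_add_left (hGm.ennreal_ofReal.const_mul _),
          lintegral_const_mul _ hGm.ennreal_ofReal]
        gcongr
    _ ≤ ENNReal.ofReal (2 * δ ^ (-P₂)) * Y ^ (1 - θ) +
          ENNReal.ofReal (δ ^ (-P₂)) * (Y ^ (1 - θ) * N ^ θ) := by
        refine add_le_add (mul_le_mul' (ENNReal.ofReal_le_ofReal (by linarith)) ?_)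
          (le_mul_of_one_le_left' (by rwa [ENNReal.one_le_ofReal]))
        calc Y = Y ^ (1 : ℝ) := (ENNReal.rpow_one Y).symm
          _ ≤ _ := ENNReal.rpow_le_rpow_of_exponent_ge hY (by linarith [hθ.1])
    _ = _ := by
        rw [ENNReal.ofReal_mul zero_le_two, ENNReal.ofReal_ofNat]
        ring

end

/-- Choice of the constants in the De Giorgi iteration. -/
lemma exists_iteration_constants (n : ℕ) {a β P θ C K ω R : ℝ} (hP : 0 < P)
    (hθ : θ ∈ Ioo (0 : ℝ) 1) (ha : n * θ < a) (hC : 0 < C) (hK : 0 < K) (hω : 0 < ω) (hR : 0 < R) :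
    ∃ A κ : ℝ, 0 < A ∧ 0 < κ ∧ ∀ δ : ℝ, 0 < δ → δ ≤ 1 → A * δ ^ κ ≤ 1 ∧
      ∃ ρ : ℝ, 0 < ρ ∧ ρ ≤ R * δ / 2 ∧ ρ ≤ 1 ∧ 2 * (δ ^ (-P) * (A * δ ^ κ)) ≤ ρ ^ n * ω ∧
        ρ ^ a * (2 / ω) * (C * (R * δ / 2) ^ (-β) * (δ ^ (-P) * K * (A * δ ^ κ) ^ (1 - θ))) ≤
          A * (δ / 2) ^ κ := by
  obtain ⟨hθ0, hθ1⟩ := hθ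
  set γ := a - n * θ with hγ
  have hγ0 : 0 < γ := sub_pos.2 ha
  set σ := β + P + θ * P with hσ
  set τ := max 1 (σ / γ) with hτ
  have hτ1 : 1 ≤ τ := le_max_left _ _
  have hτσ : σ ≤ τ * γ := (div_le_iff₀ hγ0).1 (le_max_right _ _)
  set κ := τ * n + P with hκ
  have hκ0 : 0 < κ := by positivity
  set c := min 1 (ω / 2) with hc
  have hc0 : 0 < c := lt_min one_pos (by linarith)
  have hc1 : c ≤ 1 := min_le_left _ _
  have hcω : c ≤ ω / 2 := min_le_right _ _
  set D := 2 / ω * C * K * (R / 2) ^ (-β) * c ^ (-θ) with hD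
  have hD0 : 0 < D := by positivity
  set l := min (min (R / 2) 1) ((2 ^ (-κ) / D) ^ (1 / γ)) with hl
  have hl0 : 0 < l := by positivity
  have hlR : l ≤ R / 2 := (min_le_left _ _).trans (min_le_left _ _)
  have hl1 : l ≤ 1 := (min_le_left _ _).trans (min_le_right _ _)
  have hlD : l ^ γ * D ≤ 2 ^ (-κ) := by
    rw [← le_div_iff₀ hD0]
    calc l ^ γ ≤ ((2 ^ (-κ) / D) ^ (1 / γ)) ^ γ := by
          gcongr
          exact min_le_right _ _
      _ = _ := by rw [← Real.rpow_mul (by positivity), one_div_mul_cancel hγ0.ne', Real.rpow_one]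
  refine ⟨c * l ^ n, κ, by positivity, hκ0, fun δ hδ hδ1 => ?_⟩
  set ρ := l * δ ^ τ with hρ
  have hρ0 : 0 < ρ := by positivity
  have hδτ : δ ^ τ ≤ δ := by
    simpa using Real.rpow_le_rpow_of_exponent_ge hδ hδ1 hτ1
  have hZ : c * l ^ n * δ ^ κ = c * ρ ^ n * δ ^ P := by
    rw [hρ, hκ, mul_pow, Real.rpow_add hδ, Real.rpow_mul hδ.le, Real.rpow_natCast]
    ring
  have hδκ : (δ / 2) ^ κ = δ ^ κ * 2 ^ (-κ) := by
    rw [Real.div_rpow hδ.le zero_le_two, Real.rpow_neg zero_le_two, div_eq_mul_inv]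
  have hρ1 : ρ ≤ 1 := mul_le_one₀ hl1 (by positivity) (hδτ.trans hδ1)
  have hP1 : δ ^ (-P) * δ ^ P = 1 := by rw [← Real.rpow_add hδ, neg_add_cancel, Real.rpow_zero]
  refine ⟨?_, ρ, hρ0, ?_, hρ1, ?_, ?_⟩
  · exact mul_le_one₀ (mul_le_one₀ hc1 (by positivity) (pow_le_one₀ hl0.le hl1)) (by positivity)
      (Real.rpow_le_one hδ.le hδ1 hκ0.le)
  · calc ρ ≤ R / 2 * δ := by rw [hρ]; gcongr
      _ = _ := by ring
  · rw [hZ]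
    calc 2 * (δ ^ (-P) * (c * ρ ^ n * δ ^ P)) = 2 * c * ρ ^ n * (δ ^ (-P) * δ ^ P) := by ring
      _ ≤ ω * ρ ^ n := by
        rw [hP1, mul_one]
        gcongr
        linarith
      _ = _ := mul_comm _ _
  · rw [hδκ, ← mul_assoc, hZ]
    set Z := c * ρ ^ n * δ ^ P with hZd
    have hZ0 : 0 < Z := by positivity
    have hZθ : Z ^ (1 - θ) = Z * (c ^ (-θ) * ρ ^ (-(n * θ)) * δ ^ (-(θ * P))) := by
      rw [sub_eq_add_neg, Real.rpow_add hZ0, Real.rpow_one, hZd,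
        Real.mul_rpow (by positivity) (by positivity), Real.mul_rpow hc0.le (by positivity),
        ← Real.rpow_natCast, ← Real.rpow_mul hρ0.le, ← Real.rpow_mul hδ.le]
      ring_nf
    have hRβ : (R * δ / 2) ^ (-β) = (R / 2) ^ (-β) * δ ^ (-β) := by
      rw [← Real.mul_rpow (by positivity) hδ.le]
      ring_nf
    have hργ : ρ ^ a * ρ ^ (-(n * θ)) ≤ l ^ γ * δ ^ σ := by
      rw [← Real.rpow_add hρ0, ← sub_eq_add_neg, ← hγ, hρ, Real.mul_rpow hl0.le (by positivity),
        ← Real.rpow_mul hδ.le]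
      exact mul_le_mul_of_nonneg_left (Real.rpow_le_rpow_of_exponent_ge hδ hδ1 hτσ) (by positivity)
    have hδσ : δ ^ (-β) * δ ^ (-P) * δ ^ (-(θ * P)) * δ ^ σ = 1 := by
      rw [← Real.rpow_add hδ, ← Real.rpow_add hδ, ← Real.rpow_add hδ, hσ]
      ring_nf
      exact Real.rpow_zero δ
    calc _ = (ρ ^ a * ρ ^ (-(n * θ))) * (D * Z * (δ ^ (-β) * δ ^ (-P) * δ ^ (-(θ * P)))) := by
          rw [hZθ, hRβ, hD]
          ring
      _ ≤ (l ^ γ * δ ^ σ) * (D * Z * (δ ^ (-β) * δ ^ (-P) * δ ^ (-(θ * P)))) := by gcongr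
      _ = Z * (l ^ γ * D) * (δ ^ (-β) * δ ^ (-P) * δ ^ (-(θ * P)) * δ ^ σ) := by ring
      _ ≤ Z * 2 ^ (-κ) := by
        rw [hδσ, mul_one]
        gcongr
      _ = _ := by rw [← hZ]; ring

/-- De Giorgi iteration: a subsolution whose exponent oscillates little on `B_R(x₀)` is bounded from
above on `B_{R/2}(x₀)`. -/
lemma exists_ae_le_of_isWeakSubsol {n : ℕ} (hn : 1 ≤ n) {s : ℝ} (hs : s ∈ Ioo (0 : ℝ) 1)
    {p : Rn n → Rn n → ℝ} (hp : ExponentOK p) {u : Rn n → ℝ} (hu : MemW s p u) {Ω : Set (Rn n)}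
    (hsub : IsWeakSubsol s p Ω u) {x₀ : Rn n} {R P₁ P₂ θ q M : ℝ} (hR0 : 0 < R) (hR : R ≤ 1 / 2)
    (hΩ : ball x₀ R ⊆ Ω) (hP₁ : 1 ≤ P₁) (hq : P₂ ≤ q) (hθ : θ ∈ Ioo (0 : ℝ) 1)
    (hP₂ : P₂ = (1 - θ) * P₁ + θ * q) (hθs : n * θ < s * P₁)
    (hP : ∀ x ∈ ball x₀ R, ∀ y ∈ ball x₀ R, P₁ ≤ p x y ∧ p x y ≤ P₂)
    (htail : ∀ x ∈ Ω, ∫⁻ y, ENNReal.ofReal ((max (u y) 0) ^ (p x y - 1) /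
      (1 + ‖y‖ ^ ((n : ℝ) + s * p x y))) ≤ ENNReal.ofReal M)
    (hint : ∫⁻ x in ball x₀ R, ENNReal.ofReal (max (u x) 0 ^ q) < ⊤) :
    ∃ L : ℝ, ∀ᵐ x, x ∈ ball x₀ (R / 2) → u x ≤ L := by
  have hum := hu.1
  have hP₁0 : 0 < P₁ := by linarith
  have hP₁₂ : P₁ ≤ P₂ := (hP x₀ (mem_ball_self hR0) x₀ (mem_ball_self hR0)).1.trans
    (hP x₀ (mem_ball_self hR0) x₀ (mem_ball_self hR0)).2
  have hP₂0 : 0 < P₂ := hP₁0.trans_le hP₁₂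
  have hθ1 : 0 < 1 - θ := by linarith [hθ.2]
  have hint₂ : ∫⁻ x in ball x₀ R, ENNReal.ofReal (max (u x) 0 ^ P₂) < ⊤ := by
    refine (lintegral_mono fun x => ENNReal.ofReal_le_ofReal (rpow_le_one_add_rpow
      (le_max_right (u x) 0) hP₂0.le hq)).trans_lt ?_
    have h : ∀ x, ENNReal.ofReal (1 + max (u x) 0 ^ q) = 1 + ENNReal.ofReal (max (u x) 0 ^ q) :=
      fun x => by rw [ENNReal.ofReal_add zero_le_one (by positivity), ENNReal.ofReal_one]
    simp_rw [h]
    rw [lintegral_add_left measurable_const, setLIntegral_const, one_mul]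
    exact ENNReal.add_lt_top.2 ⟨measure_ball_lt_top, hint⟩
  obtain ⟨C, β, hC, -, hCβ⟩ := exists_lintegral_interaction_le hn hs hp hu hsub hR hΩ
    (hP₁.trans hP₁₂) (fun x hx y hy => (hP x hx y hy).2) htail hint₂
  set N := ∫⁻ x in ball x₀ R, ENNReal.ofReal (max (u x) 0 ^ q) with hN
  set ω := (volume (ball (0 : Rn n) 1)).toReal with hω
  have hω0 : 0 < ω := ENNReal.toReal_pos (measure_ball_pos _ _ one_pos).ne' measure_ball_lt_top.ne
  have hωe : volume (ball (0 : Rn n) 1) = ENNReal.ofReal ω :=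
    (ENNReal.ofReal_toReal measure_ball_lt_top.ne).symm
  have hNθ : N ^ θ ≠ ⊤ := ENNReal.rpow_ne_top_of_nonneg hθ.1.le hint.ne
  set K := 2 + (N ^ θ).toReal with hK
  have hK0 : 0 < K := by positivity
  have hKe : 2 + N ^ θ = ENNReal.ofReal K := by
    rw [hK, ENNReal.ofReal_add zero_le_two ENNReal.toReal_nonneg, ENNReal.ofReal_toReal hNθ,
      ENNReal.ofReal_ofNat]
  obtain ⟨A, κ, hA, hκ, hAκ⟩ := exists_iteration_constants n hP₂0 hθ hθs hC hK0 hω0 hR0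
  set Y : ℝ → ℝ → ℝ≥0∞ := fun k r =>
    ∫⁻ x in ball x₀ r, ENNReal.ofReal (minPow P₁ P₂ (max (u x - k) 0)) with hY
  have hYm : ∀ k : ℝ, Measurable fun x => ENNReal.ofReal (minPow P₁ P₂ (max (u x - k) 0)) :=
    fun k => (measurable_minPow.comp ((hum.sub_const k).max measurable_const)).ennreal_ofReal
  have hYmono : ∀ {k k' r r' : ℝ}, k ≤ k' → r' ≤ r → Y k' r' ≤ Y k r := by
    intro k k' r r' hk hr
    refine (lintegral_mono_set (ball_subset_ball hr)).trans (lintegral_mono fun x =>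
      ENNReal.ofReal_le_ofReal (minPow_mono hP₁0.le hP₂0.le (le_max_right _ _) ?_))
    exact max_le_max_right 0 (by linarith)
  have step : ∀ L δ : ℝ, 0 ≤ L → 0 < δ → δ ≤ 1 / 2 →
      Y (L + 1 - 2 * δ) (R / 2 + R * δ) ≤ ENNReal.ofReal (A * δ ^ κ) →
      Y (L + 1 - δ) (R / 2 + R * δ / 2) ≤ ENNReal.ofReal (A * (δ / 2) ^ κ) := by
    intro L δ hL hδ hδ2 hle
    obtain ⟨hA1, ρ, hρ0, hρR, hρ1, hρω, hfin⟩ := hAκ δ hδ (by linarith)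
    have hg : 0 < R * δ / 2 := by positivity
    have hg1 : R * δ ≤ R / 2 := by nlinarith
    have hrr : R / 2 + R * δ / 2 + R * δ / 2 = R / 2 + R * δ := by ring
    have hsubR : ball x₀ (R / 2 + R * δ) ⊆ ball x₀ R := ball_subset_ball (by linarith)
    have hk : L + 1 - δ = L + 1 - 2 * δ + δ := by ring
    have hhalf : 2 * volume ({x | L + 1 - δ < u x} ∩ ball x₀ (R / 2 + R * δ / 2 + R * δ / 2)) ≤
        volume (ball x₀ ρ) := by
      have h1 := (ofReal_rpow_mul_volume_le (k := L + 1 - 2 * δ) (x₀ := x₀)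
        (r := R / 2 + R * δ) hum hP₁0 hP₁₂ hδ (by linarith)).trans hle
      rw [hrr, hk, volume_ball_eq x₀ hρ0, hωe, ← ENNReal.ofReal_mul (by positivity)]
      refine le_trans ?_ (ENNReal.ofReal_le_ofReal hρω)
      rw [ENNReal.ofReal_mul zero_le_two, ENNReal.ofReal_ofNat, ENNReal.ofReal_mul (by positivity)]
      gcongr
      calc _ = ENNReal.ofReal (δ ^ (-P₂)) * (ENNReal.ofReal (δ ^ P₂) *
            volume ({x | L + 1 - 2 * δ + δ < u x} ∩ ball x₀ (R / 2 + R * δ))) := by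
            rw [← mul_assoc, ← ENNReal.ofReal_mul (by positivity), ← Real.rpow_add hδ,
              neg_add_cancel, Real.rpow_zero, ENNReal.ofReal_one, one_mul]
        _ ≤ _ := by gcongr
    have hY1 : Y (L + 1 - 2 * δ) (R / 2 + R * δ) ≤ 1 :=
      hle.trans (by rw [← ENNReal.ofReal_one]; exact ENNReal.ofReal_le_ofReal hA1)
    have h1 := setLIntegral_minPow_le (k := L + 1 - δ) (r' := R / 2 + R * δ / 2)
      (g := R * δ / 2) hs hp hum hP₁0 (P₂ := P₂) (by
        rw [hrr]
        exact fun x hx y hy => hP x (hsubR hx) y (hsubR hy)) hρ0 hρR hρ1 hhalf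
    have h2 := hCβ (L + 1 - δ) (R / 2 + R * δ / 2) (R * δ / 2) (by linarith) hg (by linarith)
      (by linarith)
    have h3 := lintegral_excess_le (x₀ := x₀) (k := L + 1 - 2 * δ) (r := R / 2 + R * δ)
      hum hP₁0 hP₁₂ (hP₂0.trans_le hq) hθ hP₂ (by linarith) hδ (by linarith) hY1
    rw [← hk, ← hrr] at h3
    refine h1.trans (le_trans ?_ (ENNReal.ofReal_le_ofReal hfin))
    rw [ENNReal.ofReal_mul (by positivity), ENNReal.ofReal_mul (by positivity),
      ENNReal.ofReal_mul (p := C * _) (by positivity),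
      ENNReal.ofReal_mul (p := δ ^ (-P₂) * K) (by positivity), ENNReal.ofReal_mul (p := δ ^ (-P₂)) (by positivity),
      ENNReal.ofReal_div_of_pos hω0, ENNReal.ofReal_ofNat, ← hωe,
      ← ENNReal.ofReal_rpow_of_nonneg (by positivity) hθ1.le, ← hKe]
    refine mul_le_mul' le_rfl (h2.trans (mul_le_mul' le_rfl (h3.trans ?_)))
    refine mul_le_mul' (mul_le_mul' le_rfl (add_le_add le_rfl ?_)) ?_
    · refine ENNReal.rpow_le_rpow (lintegral_mono_set ?_) hθ.1.le
      rwa [hrr]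
    · rw [hrr]
      exact ENNReal.rpow_le_rpow hle hθ1.le
  obtain ⟨L, hL⟩ : ∃ L : ℕ, Y L R ≤ ENNReal.ofReal (A * (1 / 2) ^ κ) := by
    have hlim : Tendsto (fun L : ℕ => Y L R) atTop (𝓝 (∫⁻ _ in ball x₀ R, 0)) := by
      refine tendsto_lintegral_of_dominated_convergence _ (fun L => hYm L)
        (fun L => ae_of_all _ fun x => ENNReal.ofReal_le_ofReal ?_) hint₂.ne
        (ae_of_all _ fun x => ?_)
      · refine (minPow_le_rpow hP₁0 hP₁₂ le_rfl (le_max_right _ _)).trans ?_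
        have : (0 : ℝ) ≤ L := L.cast_nonneg
        have h : max (u x - L) 0 ≤ max (u x) 0 := max_le_max_right 0 (by linarith)
        exact Real.rpow_le_rpow (le_max_right _ _) h hP₂0.le
      · obtain ⟨m, hm⟩ := exists_nat_ge (u x)
        refine tendsto_const_nhds.congr' ?_
        filter_upwards [eventually_ge_atTop m] with L hL
        have : (m : ℝ) ≤ L := by exact_mod_cast hL
        rw [max_eq_right (by linarith), minPow_zero hP₁0 hP₁₂, ENNReal.ofReal_zero]
    rw [lintegral_zero] at hlim
    exact (hlim.eventually (ge_mem_nhds (ENNReal.ofReal_pos.2 (by positivity)))).exists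
  have hall : ∀ j : ℕ, Y (L + 1 - 2 * (1 / 2) ^ (j + 1)) (R / 2 + R * (1 / 2) ^ (j + 1)) ≤
      ENNReal.ofReal (A * ((1 / 2) ^ (j + 1)) ^ κ) := by
    intro j
    induction j with
    | zero =>
      rw [zero_add, pow_one]
      exact (hYmono (by linarith) (by linarith)).trans hL
    | succ j ih =>
      have := step L ((1 / 2) ^ (j + 1)) L.cast_nonneg (by positivity)
        (pow_le_of_le_one (by norm_num) (by norm_num) j.succ_ne_zero) ih
      convert this using 2 <;> ring_nf
  have hzero : Y (L + 1) (R / 2) = 0 := by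
    have h0 : Tendsto (fun j : ℕ => ENNReal.ofReal (A * ((1 / 2 : ℝ) ^ (j + 1)) ^ κ)) atTop
        (𝓝 0) := by
      have h1 : Tendsto (fun j : ℕ => (1 / 2 : ℝ) ^ (j + 1)) atTop (𝓝 0) :=
        (tendsto_pow_atTop_nhds_zero_of_lt_one (by norm_num) (by norm_num)).comp
          (tendsto_add_atTop_nat 1)
      have h2 := ENNReal.tendsto_ofReal ((h1.rpow_const (Or.inr hκ.le)).const_mul A)
      rwa [Real.zero_rpow hκ.ne', mul_zero, ENNReal.ofReal_zero] at h2
    refine le_antisymm (ge_of_tendsto' h0 fun j => (hYmono ?_ ?_).trans (hall j)) zero_le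
    · have : (0 : ℝ) < (1 / 2) ^ (j + 1) := by positivity
      linarith
    · have : 0 < R * (1 / 2) ^ (j + 1) := by positivity
      linarith
  refine ⟨L + 1, ?_⟩
  rw [← ae_restrict_iff' measurableSet_ball]
  filter_upwards [(lintegral_eq_zero_iff (hYm _)).1 hzero] with x hx
  by_contra! hlt
  have hw : 0 < max (u x - (L + 1)) 0 := lt_max_of_lt_left (by linarith)
  exact (ENNReal.ofReal_pos.2 (lt_min (Real.rpow_pos_of_pos hw P₁) (Real.rpow_pos_of_pos hw P₂))).ne'
    hx

/-- local boundedness from above of weak subsolutions. -/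
theorem statement0 {n : ℕ} (hn : 1 ≤ n) (s : ℝ) (hs : s ∈ Set.Ioo (0:ℝ) 1)
    (p : Rn n → Rn n → ℝ) (hp : ExponentOK p)
    (Ω : Set (Rn n)) (hΩo : IsOpen Ω) (hΩb : Bornology.IsBounded Ω) (hΩne : Ω.Nonempty)
    (u : Rn n → ℝ) (hu : MemW s p u) (hsub : IsWeakSubsol s p Ω u)
    (htail : ∃ M : ℝ, ∀ x ∈ Ω,
      (∫⁻ y, ENNReal.ofReal ((max (u y) 0) ^ (p x y - 1) / (1 + ‖y‖ ^ ((n : ℝ) + s * p x y))))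
        ≤ ENNReal.ofReal M) :
    ∀ x₀ ∈ Ω, ∃ r > 0, ball x₀ r ⊆ Ω ∧
      ∃ M : ℝ, ∀ᵐ x, x ∈ ball x₀ r → u x ≤ M := by
  intro x₀ hx₀
  obtain ⟨M, hM⟩ := htail
  have hn0 : (0 : ℝ) < n := by exact_mod_cast hn
  have hp₀ := hp.one_lt x₀ x₀
  have hs0 : 0 < s := hs.1
  have hn1 : (1 : ℝ) ≤ n := by exact_mod_cast hn
  set ε := min ((p x₀ x₀ - 1) / 2) (s ^ 2 / (8 * n ^ 2)) with hε
  have hε0 : 0 < ε := lt_min (by linarith) (by positivity)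
  have hε1 : ε ≤ (p x₀ x₀ - 1) / 2 := min_le_left _ _
  have hε2 : ε ≤ s ^ 2 / (8 * n ^ 2) := min_le_right _ _
  set P₁ := p x₀ x₀ - ε with hP₁
  have hP₁1 : 1 < P₁ := by linarith
  set q := P₁ + s * P₁ * (P₁ / (2 * n)) with hq
  set θ := s / (2 * n) with hθ
  set P₂ := (1 - θ) * P₁ + θ * q with hP₂
  have hθ0 : 0 < θ := by positivity
  have hθ1 : θ < 1 := by
    rw [hθ, div_lt_one (by positivity)]
    linarith [hs.2]
  have hP₁q : P₁ ≤ q := le_add_of_nonneg_right (by positivity)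
  have hP₂q : P₂ ≤ q := by nlinarith
  have hP₂ε : p x₀ x₀ + ε ≤ P₂ := by
    have h1 : P₂ = P₁ + 2 * (s ^ 2 / (8 * n ^ 2)) * P₁ ^ 2 := by
      rw [hP₂, hq, hθ]
      field_simp
      ring
    have h2 : 2 * ε ≤ 2 * (s ^ 2 / (8 * n ^ 2)) * P₁ ^ 2 :=
      (by linarith : 2 * ε ≤ 2 * (s ^ 2 / (8 * n ^ 2))).trans
        (le_mul_of_one_le_right (by positivity) (one_le_pow₀ hP₁1.le))
    linarith
  obtain ⟨δ, hδ, hδp⟩ := Metric.continuous_iff.1 hp.1 (x₀, x₀) ε hε0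
  obtain ⟨ρ, hρ, hρΩ⟩ := Metric.isOpen_iff.1 hΩo x₀ hx₀
  set R := min (min (1 / 2) ρ) (δ / 2) with hR
  have hR0 : 0 < R := by positivity
  have hR1 : R ≤ 1 / 2 := (min_le_left _ _).trans (min_le_left _ _)
  have hRρ : R ≤ ρ := (min_le_left _ _).trans (min_le_right _ _)
  have hRδ : R ≤ δ / 2 := min_le_right _ _
  have hpR : ∀ x ∈ ball x₀ (2 * R), ∀ y ∈ ball x₀ (2 * R), P₁ ≤ p x y ∧ p x y ≤ P₂ := by
    intro x hx y hy
    have hxy : dist (x, y) (x₀, x₀) < δ :=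
      max_lt ((mem_ball.1 hx).trans_le (by linarith)) ((mem_ball.1 hy).trans_le (by linarith))
    have h := abs_lt.1 (hδp _ hxy)
    constructor <;> linarith [h.1, h.2]
  have hRR : ball x₀ R ⊆ ball x₀ (2 * R) := ball_subset_ball (by linarith)
  have hRΩ : ball x₀ R ⊆ Ω := (ball_subset_ball hRρ).trans hρΩ
  have hint : ∫⁻ x in ball x₀ R, ENNReal.ofReal (max (u x) 0 ^ q) < ⊤ := by
    refine hu.lintegral_rpow_lt_top hn hs hp hR0 (by linarith)
      (fun x hx y hy => (hpR x hx y hy).1) (by linarith) ?_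
    rw [hq]
    gcongr
    linarith
  exact ⟨R / 2, by positivity, (ball_subset_ball (by linarith)).trans hRΩ,
    exists_ae_le_of_isWeakSubsol hn hs hp hu hsub hR0 hR1 hRΩ hP₁1.le hP₂q ⟨hθ0, hθ1⟩ rfl
      (by rw [hθ]; field_simp; linarith) (fun x hx y hy => hpR x (hRR hx) y (hRR hy)) hM hint⟩
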